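/- arXiv:0910.0548 — 2 statements merged into one kernel-verified Lean document; each statement's English description precedes it below -/
import Mathlib

section
/- Suppose the effectiveness functions P₁,P₂:[0,1]→[0,1] are continuously differentiable on (0,1], with P_j(0)=0, P_j(1)=1, P_j(t)<1 for t<1, P₁'(t)≥0 and P₂'(t)>0. Then there exists exactly one sequence T=(T_k)∈𝒯 satisfying condition (eqT1) at every pair (x,k) with x>0 and k∈ℕ, namely the solution of the ODE system (difeq) with initial conditions T_k(0)=1. -/
open Set

/-- The class `𝒯` of sequences `(T_k)_{k ≥ 1}` of functions: continuous on `[0,∞)`,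
continuously differentiable on `(0,∞)`, with `0 < T_k x ≤ 1`, `T_k' x < 0` and
`T_{k+1} x < T_k x` for `x > 0`, and `T_k 0 = 1`. -/
def IsClassT (T : ℕ → ℝ → ℝ) : Prop :=
  ∀ k, 1 ≤ k →
    ContinuousOn (T k) (Ici 0) ∧
    ContDiffOn ℝ 1 (T k) (Ioi 0) ∧
    (∀ x, 0 ≤ x → 0 < T k x ∧ T k x ≤ 1) ∧
    (∀ x, 0 < x → deriv (T k) x < 0) ∧
    (∀ x, 0 < x → T (k + 1) x < T k x) ∧
    T k 0 = 1

/-- Condition (eqT1) at `(x, k)`: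
`exp (∫₀ˣ log (1 - P₁ (T k β)) dβ) + ∏_{i=1}^k (1 - P₂ (T i x)) = 1`. -/
def EqT1 (P₁ P₂ : ℝ → ℝ) (T : ℕ → ℝ → ℝ) (x : ℝ) (k : ℕ) : Prop :=
  Real.exp (∫ β in (0 : ℝ)..x, Real.log (1 - P₁ (T k β))) +
    (∏ i ∈ Finset.Icc 1 k, (1 - P₂ (T i x))) = 1

/-- The right-hand side `φ_k(T₁(x), …, T_k(x))` of the `k`-th equation of the
system (difeq), for `p = 1 - P₁`, `q = 1 - P₂`, `q' = -P₂'`; for `k = 1` the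
products over `i ∈ [1,0]` are empty (equal to `1`), so the term containing `T₀`
carries the factor `1 - 1 = 0` and is absent. -/
noncomputable def difeqRHS (p q q' : ℝ → ℝ) (T : ℕ → ℝ → ℝ) (k : ℕ) (x : ℝ) : ℝ :=
  -(((1 - ∏ i ∈ Finset.Icc 1 k, q (T i x)) * Real.log (p (T k x))
      - q (T k x) * (1 - ∏ i ∈ Finset.Icc 1 (k - 1), q (T i x)) *
          Real.log (p (T (k - 1) x)))
    / (q' (T k x) * ∏ i ∈ Finset.Icc 1 (k - 1), q (T i x)))

open Filter Topology MeasureTheory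

/-- A function which starts nonpositive and is nonincreasing wherever it is positive stays
nonpositive. -/
lemma nonpos_of_hasDerivAt_nonpos {d : ℝ → ℝ} {a b : ℝ} (hc : ContinuousOn d (Icc a b))
    (ha : d a ≤ 0) (hd : ∀ x ∈ Ioo a b, 0 < d x → ∃ d' ≤ 0, HasDerivAt d d' x) :
    ∀ x ∈ Icc a b, d x ≤ 0 := by
  intro x₁ hx₁
  by_contra! hpos
  have hc₁ : ContinuousOn d (Icc a x₁) := hc.mono (Icc_subset_Icc_right hx₁.2)
  set S := Icc a x₁ ∩ d ⁻¹' Iic 0 with hS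
  have hScl : IsClosed S := hc₁.preimage_isClosed_of_isClosed isClosed_Icc isClosed_Iic
  have hSne : S.Nonempty := ⟨a, ⟨le_refl a, hx₁.1⟩, ha⟩
  have hSbd : BddAbove S := ⟨x₁, fun y hy => hy.1.2⟩
  have hx₀ : sSup S ∈ S := hScl.csSup_mem hSne hSbd
  set x₀ := sSup S
  have hx₀₁ : x₀ < x₁ := lt_of_le_of_ne hx₀.1.2 (by
    intro h
    have : d x₀ ≤ 0 := hx₀.2
    rw [h] at this
    linarith)
  have hgt : ∀ x ∈ Ioo x₀ x₁, 0 < d x := by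
    intro x hx
    by_contra! h
    exact (le_csSup hSbd ⟨⟨hx₀.1.1.trans hx.1.le, hx.2.le⟩, h⟩).not_gt hx.1
  have hder : ∀ x ∈ Ioo x₀ x₁, ∃ d' ≤ 0, HasDerivAt d d' x := fun x hx =>
    hd x ⟨hx₀.1.1.trans_lt hx.1, hx.2.trans_le hx₁.2⟩ (hgt x hx)
  have hanti : AntitoneOn d (Icc x₀ x₁) := by
    apply antitoneOn_of_deriv_nonpos (convex_Icc _ _)
      (hc₁.mono (Icc_subset_Icc_left hx₀.1.1))
    · rw [interior_Icc]
      intro x hx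
      obtain ⟨d', -, h⟩ := hder x hx
      exact h.differentiableAt.differentiableWithinAt
    · rw [interior_Icc]
      intro x hx
      obtain ⟨d', h', h⟩ := hder x hx
      rwa [h.deriv]
  have h₁ := hanti (left_mem_Icc.2 hx₀₁.le) (right_mem_Icc.2 hx₀₁.le) hx₀₁.le
  have h₂ : d x₀ ≤ 0 := hx₀.2
  linarith

/-- A function which starts nonpositive and is strictly decreasing wherever it is nonnegative is
negative at all later times. -/
lemma neg_of_hasDerivAt_neg {d : ℝ → ℝ} {a b : ℝ} (hc : ContinuousOn d (Icc a b))
    (ha : d a ≤ 0) (hd : ∀ x ∈ Ioc a b, 0 ≤ d x → ∃ d' < 0, HasDerivAt d d' x) :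
    ∀ x ∈ Ioc a b, d x < 0 := by
  have hle := nonpos_of_hasDerivAt_nonpos hc ha (fun x hx h => by
    obtain ⟨d', h', hd'⟩ := hd x (Ioo_subset_Ioc_self hx) h.le
    exact ⟨d', h'.le, hd'⟩)
  intro x hx
  refine lt_of_le_of_ne (hle x (Ioc_subset_Icc_self hx)) fun h0 => ?_
  obtain ⟨d', h', hd'⟩ := hd x hx h0.ge
  have h₁ : ∀ᶠ y in 𝓝[<] x, slope d x y < 0 :=
    (hasDerivAt_iff_tendsto_slope.1 hd').eventually_lt_const h'
      |>.filter_mono (nhdsWithin_mono _ fun y (hy : y < x) => hy.ne)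
  have h₂ : ∀ᶠ y in 𝓝[<] x, y ∈ Ioo a x := Ioo_mem_nhdsLT hx.1
  obtain ⟨y, hy₁, hy₂⟩ := (h₁.and h₂).exists
  have h₃ := hle y ⟨hy₂.1.le, hy₂.2.le.trans hx.2⟩
  rw [slope_def_field, h0, sub_zero] at hy₁
  have h₄ : 0 ≤ d y / (y - x) := div_nonneg_of_nonpos h₃ (by linarith [hy₂.2])
  linarith

/-- A function satisfying the linear differential inequality `c * G ≤ G'` that is nonpositive at
some point was nonpositive before. -/
lemma nonpos_of_mul_le_deriv {G g c : ℝ → ℝ} (hG : ∀ x, 0 < x → HasDerivAt G (g x) x)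
    (hc : ContinuousOn c (Ioi 0)) (hle : ∀ x, 0 < x → c x * G x ≤ g x) {x x₁ : ℝ}
    (hx : 0 < x) (hxx₁ : x ≤ x₁) (h₁ : G x₁ ≤ 0) : G x ≤ 0 := by
  have hC : ∀ t, 0 < t → HasDerivAt (fun u => ∫ s in x..u, c s) (c t) t := by
    intro t ht
    have hsub : uIcc x t ⊆ Ioi 0 := fun s hs => (lt_min hx ht).trans_le hs.1
    exact intervalIntegral.integral_hasDerivAt_right (hc.mono hsub).intervalIntegrable
      (hc.stronglyMeasurableAtFilter isOpen_Ioi t ht) (hc.continuousAt (Ioi_mem_nhds ht))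
  set C : ℝ → ℝ := fun u => ∫ s in x..u, c s
  have hE : ∀ t, 0 < t → HasDerivAt (fun u => G u * Real.exp (-C u))
      ((g t - c t * G t) * Real.exp (-C t)) t := by
    intro t ht
    refine ((hG t ht).mul (hC t ht).neg.exp).congr_deriv ?_
    simp only [Pi.neg_apply]
    ring
  have hmono : MonotoneOn (fun u => G u * Real.exp (-C u)) (Ioi 0) := by
    apply monotoneOn_of_deriv_nonneg (convex_Ioi 0)
    · exact fun t ht => (hE t ht).continuousAt.continuousWithinAt
    · rw [interior_Ioi]
      exact fun t ht => (hE t ht).differentiableAt.differentiableWithinAt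
    · rw [interior_Ioi]
      intro t ht
      rw [(hE t ht).deriv]
      exact mul_nonneg (sub_nonneg.2 (hle t ht)) (Real.exp_pos _).le
  have h := hmono (mem_Ioi.2 hx) (mem_Ioi.2 (hx.trans_le hxx₁)) hxx₁
  have h' : G x₁ * Real.exp (-C x₁) ≤ 0 := mul_nonpos_of_nonpos_of_nonneg h₁ (Real.exp_pos _).le
  exact nonpos_of_mul_nonpos_left (h.trans h') (Real.exp_pos _)

/-- Global existence for a bounded vector field which is Lipschitz in space. -/
lemma exists_hasDerivWithinAt_of_bounded {v : ℝ → ℝ → ℝ} {a b : ℝ} (hab : a ≤ b)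
    {K L : NNReal} (hK : ∀ t ∈ Icc a b, LipschitzWith K (v t))
    (hv : ∀ y, ContinuousOn (v · y) (Icc a b)) (hL : ∀ t ∈ Icc a b, ∀ y, ‖v t y‖ ≤ L) :
    ∃ y : ℝ → ℝ, y a = 0 ∧ ∀ t ∈ Icc a b, HasDerivWithinAt y (v t (y t)) (Icc a b) t := by
  have hPL : IsPicardLindelof v (⟨a, left_mem_Icc.2 hab⟩ : Icc a b) (0 : ℝ)
      (L * (b - a).toNNReal) 0 L K :=
    { lipschitzOnWith := fun t ht => (hK t ht).lipschitzOnWith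
      continuousOn := fun y _ => hv y
      norm_le := fun t ht y _ => hL t ht y
      mul_max_le := by
        simp [max_eq_left (sub_nonneg.2 hab)] }
  exact hPL.exists_eq_forall_mem_Icc_hasDerivWithinAt₀

/-- A nonincreasing rate function on `(0,∞)`, continuously differentiable on `(0,1)`, blowing up
at `0` and vanishing from `1` on. -/
structure IsRate (M M' : ℝ → ℝ) : Prop where
  anti : AntitoneOn M (Ioi 0)
  cont : ContinuousOn M (Ioi 0)
  eq_zero : ∀ s, 1 ≤ s → M s = 0
  tendsto : Tendsto M (𝓝[>] 0) atTop
  hasDerivAt : ∀ s ∈ Ioo (0 : ℝ) 1, HasDerivAt M (M' s) s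
  cont_deriv : ContinuousOn M' (Ioo 0 1)

namespace IsRate

variable {M M' : ℝ → ℝ}

lemma nonneg (h : IsRate M M') {s : ℝ} (hs : 0 < s) : 0 ≤ M s := by
  rw [← h.eq_zero (max s 1) (le_max_right _ _)]
  exact h.anti (mem_Ioi.2 hs) (mem_Ioi.2 (hs.trans_le (le_max_left _ _))) (le_max_left _ _)

lemma deriv_nonpos (h : IsRate M M') {s : ℝ} (hs : s ∈ Ioo (0 : ℝ) 1) : M' s ≤ 0 := by
  by_contra! hp
  have h₁ : ∀ᶠ y in 𝓝[>] s, 0 < slope M s y :=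
    (hasDerivAt_iff_tendsto_slope.1 (h.hasDerivAt s hs)).eventually_const_lt hp
      |>.filter_mono (nhdsWithin_mono _ fun y (hy : s < y) => hy.ne')
  obtain ⟨y, hy₁, hy₂⟩ := (h₁.and self_mem_nhdsWithin).exists
  have hy₂ : s < y := hy₂
  have := h.anti (mem_Ioi.2 hs.1) (mem_Ioi.2 (hs.1.trans hy₂)) hy₂.le
  rw [slope_def_field] at hy₁
  have h₄ : (M y - M s) / (y - s) ≤ 0 :=
    div_nonpos_of_nonpos_of_nonneg (by linarith) (by linarith)
  linarith

/-- The Lipschitz truncation of a rate function at level `ε`. -/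
def trunc (M : ℝ → ℝ) (ε s : ℝ) : ℝ := M (max ε (min s (1 - ε))) - M (1 - ε)

lemma trunc_anti (h : IsRate M M') {ε : ℝ} (hε : 0 < ε) : Antitone (trunc M ε) := by
  intro s t hst
  unfold trunc
  gcongr
  exact h.anti (mem_Ioi.2 (lt_max_of_lt_left hε)) (mem_Ioi.2 (lt_max_of_lt_left hε))
    (max_le_max le_rfl (min_le_min_right _ hst))

lemma trunc_nonneg (h : IsRate M M') {ε : ℝ} (hε : 0 < ε) (hε' : ε < 1 / 2) (s : ℝ) :
    0 ≤ trunc M ε s := by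
  unfold trunc
  rw [sub_nonneg]
  exact h.anti (mem_Ioi.2 (lt_max_of_lt_left hε)) (mem_Ioi.2 (by linarith))
    (max_le (by linarith) (min_le_right _ _))

lemma trunc_le (h : IsRate M M') {ε : ℝ} (hε : 0 < ε) (hε' : ε < 1 / 2) (s : ℝ) :
    trunc M ε s ≤ M ε := by
  unfold trunc
  have h₁ : M (max ε (min s (1 - ε))) ≤ M ε :=
    h.anti (mem_Ioi.2 hε) (mem_Ioi.2 (lt_max_of_lt_left hε)) (le_max_left _ _)
  have h₂ : 0 ≤ M (1 - ε) := h.nonneg (by linarith)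
  linarith

lemma trunc_mono (h : IsRate M M') {ε δ : ℝ} (hδ : 0 < δ) (hδε : δ ≤ ε) (hε' : ε < 1 / 2)
    (s : ℝ) : trunc M ε s ≤ trunc M δ s := by
  rcases le_total s (1 - ε) with hs | hs
  · unfold trunc
    rw [min_eq_left hs, min_eq_left (by linarith)]
    have h₁ : M (max ε s) ≤ M (max δ s) :=
      h.anti (mem_Ioi.2 (lt_max_of_lt_left hδ)) (mem_Ioi.2 (lt_max_of_lt_left (by linarith)))
        (max_le_max hδε le_rfl)
    have h₂ : M (1 - δ) ≤ M (1 - ε) :=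
      h.anti (mem_Ioi.2 (by linarith)) (mem_Ioi.2 (by linarith)) (by linarith)
    linarith
  · have h₁ : trunc M ε s = 0 := by
      unfold trunc
      rw [min_eq_right hs, max_eq_right (by linarith), sub_self]
    rw [h₁]
    exact h.trunc_nonneg hδ (by linarith) s

lemma trunc_le_self (h : IsRate M M') {ε s : ℝ} (hε : 0 < ε) (hε' : ε < 1 / 2) (hs : 0 < s) :
    trunc M ε s ≤ M s := by
  have h₂ : 0 ≤ M (1 - ε) := h.nonneg (by linarith)
  rcases le_total s (1 - ε) with hs' | hs'
  · unfold trunc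
    rw [min_eq_left hs']
    have h₁ : M (max ε s) ≤ M s :=
      h.anti (mem_Ioi.2 hs) (mem_Ioi.2 (lt_max_of_lt_left hε)) (le_max_right _ _)
    linarith
  · have h₁ : trunc M ε s = 0 := by
      unfold trunc
      rw [min_eq_right hs', max_eq_right (by linarith), sub_self]
    rw [h₁]
    exact h.nonneg hs

lemma sub_le_trunc (h : IsRate M M') {ε s : ℝ} (hε : 0 < ε) (hs : ε ≤ s) :
    M s - M (1 - ε) ≤ trunc M ε s := by
  unfold trunc
  gcongr
  refine h.anti (mem_Ioi.2 (lt_max_of_lt_left hε)) (mem_Ioi.2 (by linarith)) ?_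
  exact max_le hs (min_le_left _ _)

lemma exists_lipschitzWith_trunc (h : IsRate M M') {ε : ℝ} (hε : 0 < ε) (hε' : ε < 1 / 2) :
    ∃ K, LipschitzWith K (trunc M ε) := by
  have hsub : Icc ε (1 - ε) ⊆ Ioo 0 1 := fun s hs => ⟨hε.trans_le hs.1, by linarith [hs.2]⟩
  obtain ⟨C, hC⟩ := isCompact_Icc.exists_bound_of_continuousOn (h.cont_deriv.mono hsub)
  have hC0 : ‖M' ε‖ ≤ C := hC ε ⟨le_rfl, by linarith⟩
  have hLip : LipschitzOnWith C.toNNReal M (Icc ε (1 - ε)) := by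
    apply (convex_Icc ε (1 - ε)).lipschitzOnWith_of_nnnorm_hasDerivWithin_le
      (fun s hs => (h.hasDerivAt s (hsub hs)).hasDerivWithinAt)
    intro s hs
    rw [← NNReal.coe_le_coe, Real.coe_toNNReal _ ((norm_nonneg _).trans hC0)]
    exact hC s hs
  have hclip : LipschitzWith 1 (fun s : ℝ => max ε (min s (1 - ε))) :=
    (LipschitzWith.id.min_const (1 - ε)).const_max ε
  refine ⟨C.toNNReal, LipschitzWith.of_dist_le_mul fun s t => ?_⟩
  have hmem : ∀ s : ℝ, max ε (min s (1 - ε)) ∈ Icc ε (1 - ε) := fun s =>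
    ⟨le_max_left _ _, max_le (by linarith) (min_le_right _ _)⟩
  have h₁ := hLip.dist_le_mul _ (hmem s) _ (hmem t)
  have h₂ := hclip.dist_le_mul s t
  unfold trunc
  rw [dist_sub_right]
  refine h₁.trans ?_
  gcongr
  simpa using h₂

end IsRate

lemma one_sub_exp_neg_mono {y z : ℝ} (h : y ≤ z) : 1 - Real.exp (-y) ≤ 1 - Real.exp (-z) := by
  gcongr

lemma one_sub_exp_neg_pos {y : ℝ} (h : 0 < y) : 0 < 1 - Real.exp (-y) := by
  rw [sub_pos]
  simpa using h

lemma lipschitzWith_one_sub_exp_neg_max :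
    LipschitzWith 1 (fun y : ℝ => 1 - Real.exp (-max y 0)) := by
  have key : ∀ s t : ℝ, s ≤ t →
      dist (1 - Real.exp (-max s 0)) (1 - Real.exp (-max t 0)) ≤ dist s t := by
    intro s t hst
    have h₀ : 0 ≤ max s 0 := le_max_right _ _
    have h₁ : max s 0 ≤ max t 0 := max_le_max_right _ hst
    have h₂ : max t 0 - max s 0 ≤ t - s := by
      rcases le_total s 0 with hs | hs <;> rcases le_total t 0 with ht | ht <;>
        simp [hs, ht] <;> linarith
    have h₃ := one_sub_exp_neg_mono h₁
    have h₄ : Real.exp (-max s 0) ≤ 1 := Real.exp_le_one_iff.2 (by linarith)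
    have h₅ := Real.add_one_le_exp (-(max t 0 - max s 0))
    have h₆ : Real.exp (-max t 0) = Real.exp (-max s 0) * Real.exp (-(max t 0 - max s 0)) := by
      rw [← Real.exp_add]
      ring_nf
    rw [dist_comm, dist_comm s t, Real.dist_eq, Real.dist_eq, abs_of_nonneg (by linarith),
      abs_of_nonneg (by linarith)]
    have h₇ : 0 < Real.exp (-max s 0) := Real.exp_pos _
    nlinarith
  refine LipschitzWith.of_dist_le_mul fun s t => ?_
  rw [NNReal.coe_one, one_mul]
  rcases le_total s t with h | h
  · exact key s t h
  · rw [dist_comm, dist_comm s t]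
    exact key t s h

namespace IsRate

variable {M M' : ℝ → ℝ} {A : ℝ → ℝ}

lemma trunc_ratio_le {ε c t y : ℝ} (h : IsRate M M')
    (hA : ∀ x, 0 < x → 0 < A x ∧ A x ≤ 1) (hε : 0 < ε) (hε' : ε < 1 / 2) (hc : 0 < c)
    (ht : 0 < t) (hct : c ≤ y) :
    trunc M ε ((1 - Real.exp (-y)) / A t) ≤ M (1 - Real.exp (-c)) := by
  have hAt := hA t ht
  refine (h.trunc_anti hε ?_).trans (h.trunc_le_self hε hε' (one_sub_exp_neg_pos hc))
  refine (one_sub_exp_neg_mono hct).trans ?_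
  rw [le_div_iff₀ hAt.1]
  exact mul_le_of_le_one_right (one_sub_exp_neg_pos (hc.trans_le hct)).le hAt.2

/-- `y` solves, on `[ε, b]`, the truncated problem started at time `ε`. -/
structure IsApprox (M A : ℝ → ℝ) (ε b : ℝ) (y : ℝ → ℝ) : Prop where
  start : y ε = 0
  nonneg : ∀ t ∈ Icc ε b, 0 ≤ y t
  deriv : ∀ t ∈ Icc ε b,
    HasDerivWithinAt y (trunc M ε ((1 - Real.exp (-y t)) / A t)) (Icc ε b) t

lemma exists_isApprox (h : IsRate M M') (hAc : ContinuousOn A (Ioi 0))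
    (hA : ∀ x, 0 < x → 0 < A x ∧ A x ≤ 1) {ε b : ℝ} (hε : 0 < ε) (hε' : ε < 1 / 2)
    (hεb : ε ≤ b) : ∃ y, IsApprox M A ε b y := by
  obtain ⟨K, hK⟩ := h.exists_lipschitzWith_trunc hε hε'
  have hpos : ∀ t ∈ Icc ε b, 0 < t := fun t ht => hε.trans_le ht.1
  have hAc' : ContinuousOn A (Icc ε b) := hAc.mono hpos
  obtain ⟨t₀, ht₀, hmin⟩ := isCompact_Icc.exists_isMinOn (nonempty_Icc.2 hεb) hAc'
  have hm := (hA t₀ (hpos t₀ ht₀)).1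
  obtain ⟨y, hy0, hy⟩ := exists_hasDerivWithinAt_of_bounded
    (v := fun t y => trunc M ε ((1 - Real.exp (-max y 0)) / A t)) hεb
    (K := K * (A t₀)⁻¹.toNNReal) (L := (M ε).toNNReal)
    (fun t ht => by
      refine LipschitzWith.of_dist_le_mul fun s u => ?_
      refine (hK.dist_le_mul _ _).trans ?_
      rw [NNReal.coe_mul, mul_assoc]
      gcongr
      have h₁ := lipschitzWith_one_sub_exp_neg_max.dist_le_mul s u
      rw [NNReal.coe_one, one_mul] at h₁
      have hAt := (hA t (hpos t ht)).1
      have h₂ : A t₀ ≤ A t := hmin ht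
      rw [Real.coe_toNNReal _ (inv_nonneg.2 hm.le), Real.dist_eq, ← sub_div, abs_div,
        ← Real.dist_eq, abs_of_pos hAt, div_eq_inv_mul]
      gcongr)
    (fun y => hK.continuous.comp_continuousOn
      (continuousOn_const.div hAc' fun t ht => (hA t (hpos t ht)).1.ne'))
    (fun t ht y => by
      rw [Real.norm_of_nonneg (h.trunc_nonneg hε hε' _)]
      exact (h.trunc_le hε hε' _).trans (Real.le_coe_toNNReal _))
  have hmono : MonotoneOn y (Icc ε b) := by
    apply monotoneOn_of_deriv_nonneg (convex_Icc _ _)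
    · exact fun t ht => (hy t ht).continuousWithinAt
    · intro t ht
      exact ((hy t (interior_subset ht)).mono interior_subset).differentiableWithinAt
    · intro t ht
      rw [((hy t (interior_subset ht)).hasDerivAt (mem_interior_iff_mem_nhds.1 ht)).deriv]
      exact h.trunc_nonneg hε hε' _
  have hnn : ∀ t ∈ Icc ε b, 0 ≤ y t := fun t ht => by
    rw [← hy0]
    exact hmono (left_mem_Icc.2 hεb) ht ht.1
  refine ⟨y, hy0, hnn, fun t ht => ?_⟩
  have := hy t ht
  simp only [max_eq_left (hnn t ht)] at this
  exact this

namespace IsApprox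

variable {ε δ b c : ℝ} {y z : ℝ → ℝ}

lemma continuousOn (hy : IsApprox M A ε b y) : ContinuousOn y (Icc ε b) :=
  fun t ht => (hy.deriv t ht).continuousWithinAt

lemma hasDerivAt (hy : IsApprox M A ε b y) {t : ℝ} (ht : t ∈ Ioo ε b) :
    HasDerivAt y (trunc M ε ((1 - Real.exp (-y t)) / A t)) t :=
  (hy.deriv t (Ioo_subset_Icc_self ht)).hasDerivAt (Icc_mem_nhds ht.1 ht.2)

lemma monotoneOn (hy : IsApprox M A ε b y) (h : IsRate M M') (hε : 0 < ε) (hε' : ε < 1 / 2) :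
    MonotoneOn y (Icc ε b) := by
  apply monotoneOn_of_deriv_nonneg (convex_Icc _ _) hy.continuousOn
  · rw [interior_Icc]
    exact fun t ht => (hy.hasDerivAt ht).differentiableAt.differentiableWithinAt
  · rw [interior_Icc]
    intro t ht
    rw [(hy.hasDerivAt ht).deriv]
    exact h.trunc_nonneg hε hε' _

lemma le_linear (hy : IsApprox M A ε b y) (h : IsRate M M')
    (hA : ∀ x, 0 < x → 0 < A x ∧ A x ≤ 1) (hε : 0 < ε) (hε' : ε < 1 / 2) (hc : 0 < c)
    {t : ℝ} (ht : t ∈ Icc ε b) : y t ≤ c + M (1 - Real.exp (-c)) * t := by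
  have hM : 0 ≤ M (1 - Real.exp (-c)) := h.nonneg (one_sub_exp_neg_pos hc)
  have key := nonpos_of_hasDerivAt_nonpos
    (d := fun t => y t - (c + M (1 - Real.exp (-c)) * t)) (a := ε) (b := b)
    (hy.continuousOn.sub (by fun_prop)) (by
      rw [hy.start]
      have := mul_nonneg hM hε.le
      linarith) (fun x hx hpos => by
      have hlin : HasDerivAt (fun t => c + M (1 - Real.exp (-c)) * t)
          (M (1 - Real.exp (-c))) x := by
        simpa using ((hasDerivAt_id x).const_mul (M (1 - Real.exp (-c)))).const_add c
      refine ⟨_, ?_, (hy.hasDerivAt hx).sub hlin⟩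
      have h₁ := mul_nonneg hM (hε.trans hx.1).le
      have h₂ := h.trunc_ratio_le hA hε hε' hc (hε.trans hx.1)
        (y := y x) (by linarith)
      linarith)
  linarith [key t ht]

lemma le_of_trunc_le (hy : IsApprox M A ε b y) {b' : ℝ} (hz : IsApprox M A δ b' z)
    (h : IsRate M M')
    (hA : ∀ x, 0 < x → 0 < A x ∧ A x ≤ 1) (hδ : 0 < δ) (hδε : δ ≤ ε) (hε' : ε < 1 / 2)
    (hb : b ≤ b') {t : ℝ} (ht : t ∈ Icc ε b) : y t ≤ z t := by
  have hsub : Icc ε b ⊆ Icc δ b' := Icc_subset_Icc hδε hb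
  have key := nonpos_of_hasDerivAt_nonpos (d := fun t => y t - z t) (a := ε) (b := b)
    (hy.continuousOn.sub (hz.continuousOn.mono hsub)) (by
      rw [hy.start]
      linarith [hz.nonneg ε (hsub ⟨le_rfl, ht.1.trans ht.2⟩)]) (fun x hx hpos => by
      refine ⟨_, ?_, (hy.hasDerivAt hx).sub
        (hz.hasDerivAt ⟨hδε.trans_lt hx.1, hx.2.trans_le hb⟩)⟩
      have hAt := hA x (hδ.trans_le (hδε.trans hx.1.le))
      rw [sub_nonpos]
      refine (h.trunc_mono hδ hδε hε' _).trans (h.trunc_anti hδ ?_)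
      have := one_sub_exp_neg_mono (sub_pos.1 hpos).le
      exact div_le_div_of_nonneg_right this hAt.1.le)
  linarith [key t ht]

lemma pos (hy : IsApprox M A ε b y) (h : IsRate M M') (hε : 0 < ε) (hε' : ε < 1 / 2)
    (hM : M (1 - ε) < M ε) {t : ℝ} (ht : t ∈ Ioc ε b) : 0 < y t := by
  have ht' := Ioc_subset_Icc_self ht
  refine lt_of_le_of_ne (hy.nonneg t ht') fun h0 => ?_
  have hsub : Icc ε t ⊆ Icc ε b := Icc_subset_Icc_right ht.2
  have hz : ∀ s ∈ Icc ε t, y s = 0 := fun s hs =>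
    le_antisymm (h0 ▸ hy.monotoneOn h hε hε' (hsub hs) ht' hs.2) (hy.nonneg s (hsub hs))
  have hεt : ε ∈ Icc ε t := left_mem_Icc.2 ht.1.le
  have h₁ := (hy.deriv ε (hsub hεt)).mono hsub
  have h₂ : HasDerivWithinAt y 0 (Icc ε t) ε :=
    (hasDerivWithinAt_const ε (Icc ε t) (0 : ℝ)).congr hz (hz ε hεt)
  have h₃ := (uniqueDiffOn_Icc ht.1 ε hεt).eq_deriv _ h₁ h₂
  rw [hy.start] at h₃
  simp only [trunc, neg_zero, Real.exp_zero, sub_self, zero_div] at h₃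
  rw [min_eq_left (by linarith), max_eq_left hε.le] at h₃
  linarith

end IsApprox

end IsRate

namespace IsRate

variable {M M' : ℝ → ℝ} {A : ℝ → ℝ}

/-- The singular initial value problem `y' = M ((1 - exp (-y)) / A)`, `y 0 = 0`, has a solution. -/
lemma exists_solution (h : IsRate M M') (hAc : ContinuousOn A (Ioi 0))
    (hA : ∀ x, 0 < x → 0 < A x ∧ A x ≤ 1) :
    ∃ y : ℝ → ℝ, y 0 = 0 ∧ ContinuousOn y (Ici 0) ∧
      ∀ x, 0 < x → 0 < y x ∧ HasDerivAt y (M ((1 - Real.exp (-y x)) / A x)) x := by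
  set ε : ℕ → ℝ := fun n => 1 / ((n : ℝ) + 3) with hεdef
  set b : ℕ → ℝ := fun n => (n : ℝ) + 3 with hbdef
  have hε : ∀ n, 0 < ε n := fun n => by simp only [hεdef]; positivity
  have hε' : ∀ n, ε n < 1 / 2 := fun n => by
    simp only [hεdef]
    apply one_div_lt_one_div_of_lt (by norm_num)
    have : (0 : ℝ) ≤ n := n.cast_nonneg
    linarith
  have hεb : ∀ n, ε n ≤ b n := fun n => by
    have : (0 : ℝ) ≤ n := n.cast_nonneg
    have := hε' n
    simp only [hbdef]
    linarith
  have hεanti : Antitone ε := fun m n hmn => by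
    simp only [hεdef]
    gcongr
  have hbmono : Monotone b := fun m n hmn => by
    simp only [hbdef]
    gcongr
  have hεlim : Tendsto ε atTop (𝓝[>] 0) := by
    refine tendsto_nhdsWithin_iff.2 ⟨?_, Eventually.of_forall hε⟩
    exact tendsto_const_nhds.div_atTop (tendsto_natCast_atTop_atTop.atTop_add tendsto_const_nhds)
  have hblim : Tendsto b atTop atTop := tendsto_natCast_atTop_atTop.atTop_add tendsto_const_nhds
  have hM1 : Tendsto (fun n => M (1 - ε n)) atTop (𝓝 0) := by
    have h₁ : Tendsto (fun n => 1 - ε n) atTop (𝓝 1) := by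
      simpa using (hεlim.mono_right nhdsWithin_le_nhds).const_sub 1
    have h₂ : ContinuousAt M 1 := h.cont.continuousAt (Ioi_mem_nhds one_pos)
    have h₃ := h₂.tendsto.comp h₁
    rwa [h.eq_zero 1 le_rfl] at h₃
  choose y hy using fun n => h.exists_isApprox hAc hA (hε n) (hε' n) (hεb n)
  set z : ℕ → ℝ → ℝ := fun n => (Icc (ε n) (b n)).indicator (y n) with hz
  have hz_eq : ∀ n t, t ∈ Icc (ε n) (b n) → z n t = y n t := fun n t ht =>
    indicator_of_mem ht _
  have hz_nonneg : ∀ n t, 0 ≤ z n t := fun n t => indicator_nonneg (hy n).nonneg t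
  have hz_mono : ∀ t, Monotone fun n => z n t := by
    intro t m n hmn
    by_cases ht : t ∈ Icc (ε m) (b m)
    · simp only [hz_eq m t ht,
        hz_eq n t (Icc_subset_Icc (hεanti hmn) (hbmono hmn) ht)]
      exact (hy m).le_of_trunc_le (hy n) h hA (hε n) (hεanti hmn) (hε' m) (hbmono hmn) ht
    · simp only [hz, indicator_of_notMem ht]
      exact hz_nonneg n t
  have hz_le : ∀ n t c, 0 < c → 0 ≤ t → z n t ≤ c + M (1 - Real.exp (-c)) * t := by
    intro n t c hc ht
    by_cases htm : t ∈ Icc (ε n) (b n)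
    · rw [hz_eq n t htm]
      exact (hy n).le_linear h hA (hε n) (hε' n) hc htm
    · have := mul_nonneg (h.nonneg (one_sub_exp_neg_pos hc)) ht
      simp only [hz, indicator_of_notMem htm]
      linarith
  set Y : ℝ → ℝ := fun t => ⨆ n, z n t with hY
  have hbdd : ∀ t, 0 ≤ t → BddAbove (range fun n => z n t) := fun t ht =>
    ⟨1 + M (1 - Real.exp (-1)) * t, by
      rintro _ ⟨n, rfl⟩
      exact hz_le n t 1 one_pos ht⟩
  have hlim : ∀ t, 0 ≤ t → Tendsto (fun n => z n t) atTop (𝓝 (Y t)) := fun t ht =>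
    tendsto_atTop_ciSup (hz_mono t) (hbdd t ht)
  have hzY : ∀ n t, 0 ≤ t → z n t ≤ Y t := fun n t ht => le_ciSup (hbdd t ht) n
  have hY_le : ∀ t c, 0 < c → 0 ≤ t → Y t ≤ c + M (1 - Real.exp (-c)) * t := fun t c hc ht =>
    ciSup_le fun n => hz_le n t c hc ht
  have hY_nonneg : ∀ t, 0 ≤ t → 0 ≤ Y t := fun t ht => (hz_nonneg 0 t).trans (hzY 0 t ht)
  have hmain : ∀ x, 0 < x → 0 < Y x ∧ HasDerivAt Y (M ((1 - Real.exp (-Y x)) / A x)) x := by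
    intro x hx
    have hev : ∀ᶠ n in atTop, ε n < x / 2 ∧ 2 * x < b n ∧ M (1 - ε n) < M (ε n) := by
      have h₁ : ∀ᶠ n in atTop, ε n < x / 2 :=
        (hεlim.mono_right nhdsWithin_le_nhds).eventually_lt_const (by linarith)
      have h₂ : ∀ᶠ n in atTop, 2 * x < b n := hblim.eventually_gt_atTop _
      have h₃ : ∀ᶠ n in atTop, M (1 - ε n) < 1 := hM1.eventually_lt_const one_pos
      have h₄ : ∀ᶠ n in atTop, 1 ≤ M (ε n) := (h.tendsto.comp hεlim).eventually_ge_atTop 1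
      filter_upwards [h₁, h₂, h₃, h₄] with n h₁ h₂ h₃ h₄
      exact ⟨h₁, h₂, h₃.trans_le h₄⟩
    obtain ⟨N, hN⟩ := eventually_atTop.1 hev
    have hsub : ∀ n, N ≤ n → Icc (x / 2) (2 * x) ⊆ Ioo (ε n) (b n) := fun n hn t ht =>
      ⟨(hN n hn).1.trans_le ht.1, ht.2.trans_lt (hN n hn).2.1⟩
    have hab : x / 2 ≤ 2 * x := by linarith
    have ha : x / 2 ∈ Icc (x / 2) (2 * x) := ⟨le_rfl, hab⟩
    set η := y N (x / 2) with hη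
    have hηpos : 0 < η := (hy N).pos h (hε N) (hε' N) (hN N le_rfl).2.2
      (Ioo_subset_Ioc_self (hsub N le_rfl ha))
    have hyη : ∀ n, N ≤ n → ∀ t ∈ Icc (x / 2) (2 * x), η ≤ y n t := by
      intro n hn t ht
      have h₁ := hz_mono (x / 2) hn
      simp only [hz_eq N _ (Ioo_subset_Icc_self (hsub N le_rfl ha)),
        hz_eq n _ (Ioo_subset_Icc_self (hsub n hn ha))] at h₁
      exact h₁.trans ((hy n).monotoneOn h (hε n) (hε' n)
        (Ioo_subset_Icc_self (hsub n hn ha)) (Ioo_subset_Icc_self (hsub n hn ht)) ht.1)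
    have hlimy : ∀ t ∈ Icc (x / 2) (2 * x), Tendsto (fun n => y n t) atTop (𝓝 (Y t)) := by
      intro t ht
      refine (hlim t (by linarith [ht.1])).congr' ?_
      filter_upwards [eventually_ge_atTop N] with n hn
      exact hz_eq n t (Ioo_subset_Icc_self (hsub n hn ht))
    have hYη : ∀ t ∈ Icc (x / 2) (2 * x), η ≤ Y t := fun t ht =>
      ge_of_tendsto (hlimy t ht) (by
        filter_upwards [eventually_ge_atTop N] with n hn using hyη n hn t ht)
    set C := M (1 - Real.exp (-η)) with hC
    set f : ℕ → ℝ → ℝ := fun n t => trunc M (ε n) ((1 - Real.exp (-y n t)) / A t) with hf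
    have hf_nonneg : ∀ n t, 0 ≤ f n t := fun n t => h.trunc_nonneg (hε n) (hε' n) _
    have hf_le : ∀ n, N ≤ n → ∀ t ∈ Icc (x / 2) (2 * x), f n t ≤ C := fun n hn t ht =>
      h.trunc_ratio_le hA (hε n) (hε' n) hηpos (by linarith [ht.1]) (hyη n hn t ht)
    have hder : ∀ n, N ≤ n → ∀ t ∈ Icc (x / 2) (2 * x), HasDerivAt (y n) (f n t) t :=
      fun n hn t ht => (hy n).hasDerivAt (hsub n hn ht)
    have hCnn : 0 ≤ C := h.nonneg (one_sub_exp_neg_pos hηpos)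
    have hYlip : LipschitzOnWith C.toNNReal Y (Icc (x / 2) (2 * x)) := by
      refine LipschitzOnWith.of_dist_le_mul fun s hs t ht => ?_
      refine le_of_tendsto ((hlimy s hs).dist (hlimy t ht)) ?_
      filter_upwards [eventually_ge_atTop N] with n hn
      refine LipschitzOnWith.dist_le_mul ?_ s hs t ht
      refine (convex_Icc _ _).lipschitzOnWith_of_nnnorm_hasDerivWithin_le
        (fun s hs => (hder n hn s hs).hasDerivWithinAt) fun s hs => ?_
      rw [← NNReal.coe_le_coe, Real.coe_toNNReal _ hCnn, coe_nnnorm,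
        Real.norm_of_nonneg (hf_nonneg n s)]
      exact hf_le n hn s hs
    have hpos : ∀ t ∈ Icc (x / 2) (2 * x), 0 < t := fun t ht => by linarith [ht.1]
    have hratio : ∀ t ∈ Icc (x / 2) (2 * x), ∀ u, η ≤ u →
        1 - Real.exp (-η) ≤ (1 - Real.exp (-u)) / A t := by
      intro t ht u hu
      have hAt := hA t (hpos t ht)
      rw [le_div_iff₀ hAt.1]
      exact (mul_le_of_le_one_right (one_sub_exp_neg_pos hηpos).le hAt.2).trans
        (one_sub_exp_neg_mono hu)
    set g : ℝ → ℝ := fun t => M ((1 - Real.exp (-Y t)) / A t) with hg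
    have hgc : ContinuousOn g (Icc (x / 2) (2 * x)) := by
      refine h.cont.comp (ContinuousOn.div (continuousOn_const.sub
        (Real.continuous_exp.comp_continuousOn hYlip.continuousOn.neg))
        (hAc.mono hpos) fun t ht => (hA t (hpos t ht)).1.ne') fun t ht => ?_
      exact (one_sub_exp_neg_pos hηpos).trans_le (hratio t ht _ (hYη t ht))
    have hfg : ∀ t ∈ Icc (x / 2) (2 * x), Tendsto (fun n => f n t) atTop (𝓝 (g t)) := by
      intro t ht
      have hAt := (hA t (hpos t ht)).1
      have hr : Tendsto (fun n => M ((1 - Real.exp (-y n t)) / A t)) atTop (𝓝 (g t)) := by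
        have hM : ContinuousAt M ((1 - Real.exp (-Y t)) / A t) := h.cont.continuousAt
          (Ioi_mem_nhds ((one_sub_exp_neg_pos hηpos).trans_le (hratio t ht _ (hYη t ht))))
        refine hM.tendsto.comp (Tendsto.div_const (Tendsto.const_sub 1 ?_) _)
        exact (Real.continuous_exp.tendsto _).comp (hlimy t ht).neg
      have hr' : Tendsto (fun n => M ((1 - Real.exp (-y n t)) / A t) - M (1 - ε n)) atTop
          (𝓝 (g t)) := by
        simpa using hr.sub hM1
      refine tendsto_of_tendsto_of_tendsto_of_le_of_le' hr' hr ?_ ?_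
      · have h₁ : ∀ᶠ n in atTop, ε n < 1 - Real.exp (-η) :=
          (hεlim.mono_right nhdsWithin_le_nhds).eventually_lt_const (one_sub_exp_neg_pos hηpos)
        filter_upwards [eventually_ge_atTop N, h₁] with n hn h₁
        exact h.sub_le_trunc (hε n) (h₁.le.trans (hratio t ht _ (hyη n hn t ht)))
      · filter_upwards [eventually_ge_atTop N] with n hn
        exact h.trunc_le_self (hε n) (hε' n)
          ((one_sub_exp_neg_pos hηpos).trans_le (hratio t ht _ (hyη n hn t ht)))
    have hint : ∀ u ∈ Icc (x / 2) (2 * x), Y u = Y (x / 2) + ∫ t in (x / 2)..u, g t := by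
      intro u hu
      have hsubu : Icc (x / 2) u ⊆ Icc (x / 2) (2 * x) := Icc_subset_Icc_right hu.2
      have hFTC : ∀ n, N ≤ n → IntervalIntegrable (f n) volume (x / 2) u ∧
          ∫ t in (x / 2)..u, f n t = y n u - y n (x / 2) := by
        intro n hn
        have hcont : ContinuousOn (y n) (Icc (x / 2) u) := fun t ht =>
          (hder n hn t (hsubu ht)).continuousAt.continuousWithinAt
        have hd : ∀ t ∈ Ioo (x / 2) u, HasDerivAt (y n) (f n t) t := fun t ht =>
          hder n hn t (hsubu (Ioo_subset_Icc_self ht))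
        have hI : IntervalIntegrable (f n) volume (x / 2) u :=
          (intervalIntegrable_iff_integrableOn_Ioc_of_le hu.1).2
            (intervalIntegral.integrableOn_deriv_of_nonneg hcont hd fun t _ => hf_nonneg n t)
        exact ⟨hI, intervalIntegral.integral_eq_sub_of_hasDerivAt_of_le hu.1 hcont hd hI⟩
      have huIoc : ∀ t ∈ uIoc (x / 2) u, t ∈ Icc (x / 2) (2 * x) := fun t ht => by
        rw [uIoc_of_le hu.1] at ht
        exact hsubu (Ioc_subset_Icc_self ht)
      have hDCT : Tendsto (fun n => ∫ t in (x / 2)..u, f n t) atTop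
          (𝓝 (∫ t in (x / 2)..u, g t)) := by
        refine intervalIntegral.tendsto_integral_filter_of_dominated_convergence (fun _ => C)
          ?_ ?_ intervalIntegrable_const ?_
        · filter_upwards [eventually_ge_atTop N] with n hn
          exact (hFTC n hn).1.def'.aestronglyMeasurable
        · filter_upwards [eventually_ge_atTop N] with n hn
          refine Eventually.of_forall fun t ht => ?_
          rw [Real.norm_of_nonneg (hf_nonneg n t)]
          exact hf_le n hn t (huIoc t ht)
        · exact Eventually.of_forall fun t ht => hfg t (huIoc t ht)
      have hlim' : Tendsto (fun n => ∫ t in (x / 2)..u, f n t) atTop (𝓝 (Y u - Y (x / 2))) := by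
        refine ((hlimy u hu).sub (hlimy _ ha)).congr' ?_
        filter_upwards [eventually_ge_atTop N] with n hn
        exact (hFTC n hn).2.symm
      have := tendsto_nhds_unique hDCT hlim'
      linarith
    have hxm : x ∈ Icc (x / 2) (2 * x) := ⟨by linarith, by linarith⟩
    have hxn : Icc (x / 2) (2 * x) ∈ 𝓝 x := Icc_mem_nhds (by linarith) (by linarith)
    refine ⟨hηpos.trans_le (hYη x hxm), ?_⟩
    have hprim : HasDerivAt (fun u => Y (x / 2) + ∫ t in (x / 2)..u, g t) (g x) x := by
      refine HasDerivAt.const_add _ (intervalIntegral.integral_hasDerivAt_right ?_ ?_ ?_)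
      · exact (hgc.mono (by
          rw [uIcc_of_le (by linarith)]
          exact Icc_subset_Icc_right hxm.2)).intervalIntegrable
      · exact (hgc.mono Ioo_subset_Icc_self).stronglyMeasurableAtFilter isOpen_Ioo x
          ⟨by linarith, by linarith⟩
      · exact hgc.continuousAt hxn
    exact hprim.congr_of_eventuallyEq (by filter_upwards [hxn] with u hu using hint u hu)
  have hY0 : Y 0 = 0 := by
    refine le_antisymm (le_of_forall_pos_le_add fun c hc => ?_) (hY_nonneg 0 le_rfl)
    simpa using hY_le 0 c hc le_rfl
  refine ⟨Y, hY0, fun x hx => ?_, hmain⟩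
  rcases (mem_Ici.1 hx).eq_or_lt with rfl | hx
  · rw [ContinuousWithinAt, hY0, Metric.tendsto_nhdsWithin_nhds]
    intro δ hδ
    have hM := h.nonneg (one_sub_exp_neg_pos (half_pos hδ))
    refine ⟨δ / 2 / (M (1 - Real.exp (-(δ / 2))) + 1), by positivity, fun t ht htd => ?_⟩
    have ht : 0 ≤ t := ht
    rw [Real.dist_eq, sub_zero, abs_of_nonneg ht, lt_div_iff₀ (by positivity)] at htd
    rw [Real.dist_eq, sub_zero, abs_of_nonneg (hY_nonneg t ht)]
    have := hY_le t (δ / 2) (half_pos hδ) ht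
    nlinarith
  · exact (hmain x hx).2.continuousAt.continuousWithinAt

end IsRate

/-- If `r` starts from `0`, is positive afterwards, and its derivative `G / A` is such that `G`
satisfies a linear differential inequality `c * G ≤ G'`, then `G` is positive. -/
lemma pos_of_mul_le_deriv {r G A g c : ℝ → ℝ} (hrc : ContinuousOn r (Ici 0)) (hr0 : r 0 = 0)
    (hr : ∀ x, 0 < x → 0 < r x) (hA : ∀ x, 0 < x → 0 < A x)
    (hrd : ∀ x, 0 < x → HasDerivAt r (G x / A x) x)
    (hG : ∀ x, 0 < x → HasDerivAt G (g x) x) (hc : ContinuousOn c (Ioi 0))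
    (hle : ∀ x, 0 < x → c x * G x ≤ g x) {x : ℝ} (hx : 0 < x) : 0 < G x := by
  by_contra! h
  have key := nonpos_of_hasDerivAt_nonpos (d := r) (a := 0) (b := x)
    (hrc.mono Icc_subset_Ici_self) hr0.le (fun t ht _ =>
      ⟨_, div_nonpos_of_nonpos_of_nonneg (nonpos_of_mul_le_deriv hG hc hle ht.1 ht.2.le h)
        (hA t ht.1).le, hrd t ht.1⟩) x ⟨hx.le, le_rfl⟩
  exact key.not_gt (hr x hx)

/-- `B` is the solution of `B' = (1 - B) * M (B / A)` on `(0,∞)` starting from `0`. -/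
structure IsNext (M A B : ℝ → ℝ) : Prop where
  cont : ContinuousOn B (Ici 0)
  zero : B 0 = 0
  pos : ∀ x, 0 < x → 0 < B x
  lt_one : ∀ x, 0 < x → B x < 1
  hasDerivAt : ∀ x, 0 < x → HasDerivAt B ((1 - B x) * M (B x / A x)) x

/-- The ratio `r` of two consecutive solutions increases from `0` and stays below `1`. -/
structure IsGood (M A r : ℝ → ℝ) : Prop where
  cont : ContinuousOn r (Ici 0)
  zero : r 0 = 0
  pos : ∀ x, 0 < x → 0 < r x
  lt_one : ∀ x, 0 < x → r x < 1
  diff : ∀ x, 0 < x → DifferentiableAt ℝ r x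
  deriv_pos : ∀ x, 0 < x → 0 < deriv r x
  deriv_le : ∀ x, 0 < x → deriv r x * A x ≤ M (r x) * (1 - r x)

namespace IsRate

variable {M M' : ℝ → ℝ} {A B C : ℝ → ℝ}

lemma exists_isNext (h : IsRate M M') (hAc : ContinuousOn A (Ioi 0))
    (hA : ∀ x, 0 < x → 0 < A x ∧ A x ≤ 1) : ∃ B, IsNext M A B := by
  obtain ⟨y, hy0, hyc, hy⟩ := h.exists_solution hAc hA
  refine ⟨fun x => 1 - Real.exp (-y x), ?_, by simp [hy0], ?_, ?_, ?_⟩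
  · exact continuousOn_const.sub (Real.continuous_exp.comp_continuousOn hyc.neg)
  · exact fun x hx => one_sub_exp_neg_pos (hy x hx).1
  · exact fun x hx => sub_lt_self _ (Real.exp_pos _)
  · intro x hx
    refine ((hy x hx).2.neg.exp.const_sub 1).congr_deriv ?_
    simp only [Pi.neg_apply]
    ring

lemma isNext_unique (h : IsRate M M') (hA : ∀ x, 0 < x → 0 < A x) (hB : IsNext M A B)
    (hC : IsNext M A C) {x : ℝ} (hx : 0 ≤ x) : B x = C x := by
  have key : ∀ {B C : ℝ → ℝ}, IsNext M A B → IsNext M A C → B x ≤ C x := by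
    intro B C hB hC
    rw [← sub_nonpos]
    refine nonpos_of_hasDerivAt_nonpos (d := fun x => B x - C x) (a := 0) (b := x)
      ((hB.cont.sub hC.cont).mono Icc_subset_Ici_self) (by simp [hB.zero, hC.zero])
      (fun t ht hpos => ⟨_, ?_, (hB.hasDerivAt t ht.1).sub (hC.hasDerivAt t ht.1)⟩) x
      ⟨hx, le_rfl⟩
    rw [sub_nonpos]
    have hAt := hA t ht.1
    have hCpos := div_pos (hC.pos t ht.1) hAt
    have hlt := sub_pos.1 hpos
    have hdiv : C t / A t ≤ B t / A t := by gcongr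
    have hM : M (B t / A t) ≤ M (C t / A t) :=
      h.anti (mem_Ioi.2 hCpos) (mem_Ioi.2 (hCpos.trans_le hdiv)) hdiv
    have := hB.lt_one t ht.1
    exact mul_le_mul (by linarith) hM (h.nonneg (hCpos.trans_le hdiv))
      (by linarith [hC.lt_one t ht.1])
  exact le_antisymm (key hB hC) (key hC hB)

lemma isGood_of_isNext_one (h : IsRate M M') (hB : IsNext M (fun _ => 1) B) :
    IsGood M (fun _ => 1) (fun x => B x / 1) := by
  have hd : ∀ x, 0 < x → HasDerivAt B ((1 - B x) * M (B x) / 1) x := fun x hx => by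
    simpa using hB.hasDerivAt x hx
  have hmem : ∀ x, 0 < x → B x ∈ Ioo 0 1 := fun x hx => ⟨hB.pos x hx, hB.lt_one x hx⟩
  have hMd : ∀ x, 0 < x → HasDerivAt (fun x => M (B x)) (M' (B x) * ((1 - B x) * M (B x) / 1)) x :=
    fun x hx => (h.hasDerivAt _ (hmem x hx)).comp x (hd x hx)
  have hBc : ContinuousOn B (Ioi 0) := hB.cont.mono Ioi_subset_Ici_self
  have hG : ∀ x, 0 < x → 0 < (1 - B x) * M (B x) := fun x hx =>
    pos_of_mul_le_deriv (c := fun x => -M (B x) + (1 - B x) * M' (B x))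
      hB.cont hB.zero hB.pos (fun _ _ => one_pos) hd
      (fun x hx => ((hd x hx).const_sub 1).mul (hMd x hx))
      ((h.cont.comp hBc hB.pos).neg.add
        ((continuousOn_const.sub hBc).mul (h.cont_deriv.comp hBc hmem)))
      (fun x hx => le_of_eq (by ring)) hx
  simp only [div_one] at hd ⊢
  refine ⟨hB.cont, hB.zero, hB.pos, hB.lt_one, fun x hx => (hd x hx).differentiableAt,
    fun x hx => ?_, fun x hx => ?_⟩
  · rw [(hd x hx).deriv]
    exact hG x hx
  · rw [(hd x hx).deriv]
    exact le_of_eq (by ring)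

/-- The ratio of consecutive solutions inherits its properties from the preceding ratio, and
exceeds it. -/
lemma isGood_succ (h : IsRate M M') (hA : ∀ x, 0 < x → 0 < A x) (hB : IsNext M A B)
    (hC : IsNext M B C) (hr : IsGood M A (fun x => B x / A x)) :
    IsGood M B (fun x => C x / B x) ∧ ∀ x, 0 < x → B x / A x < C x / B x := by
  set r : ℝ → ℝ := fun x => B x / A x with hrdef
  set s : ℝ → ℝ := fun x => C x / B x with hsdef
  set G : ℝ → ℝ := fun x => (1 - C x) * M (s x) - s x * ((1 - B x) * M (r x)) with hGdef
  have hBd : ∀ x, 0 < x → HasDerivAt B ((1 - B x) * M (r x)) x := hB.hasDerivAt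
  have hCd : ∀ x, 0 < x → HasDerivAt C ((1 - C x) * M (s x)) x := hC.hasDerivAt
  have hspos : ∀ x, 0 < x → 0 < s x := fun x hx => div_pos (hC.pos x hx) (hB.pos x hx)
  have hCs : ∀ x, 0 < x → C x = s x * B x := fun x hx =>
    (div_mul_cancel₀ _ (hB.pos x hx).ne').symm
  have hBr : ∀ x, 0 < x → B x = r x * A x := fun x hx =>
    (div_mul_cancel₀ _ (hA x hx).ne').symm
  have hMr : ∀ x, 0 < x → 0 < M (r x) := by
    intro x hx
    have h₁ := hr.lt_one x hx
    have h₂ := (mul_pos (hr.deriv_pos x hx) (hA x hx)).trans_le (hr.deriv_le x hx)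
    exact pos_of_mul_pos_left h₂ (by linarith)
  have hsd : ∀ x, 0 < x → HasDerivAt s (G x / B x) x := by
    intro x hx
    have hBx := (hB.pos x hx).ne'
    refine ((hCd x hx).div (hBd x hx) hBx).congr_deriv ?_
    simp only [hGdef, hsdef]
    field_simp
  have hs0 : s 0 = 0 := by simp [hsdef, hC.zero]
  have hsmall : ∀ c, 0 < c → ∃ δ > 0, ∀ x, 0 < x → x ≤ δ → s x ≤ c := by
    intro c hc
    have hr₀ : Tendsto r (𝓝[>] 0) (𝓝[>] 0) := by
      refine tendsto_nhdsWithin_iff.2 ⟨?_, ?_⟩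
      · have := (hr.cont 0 self_mem_Ici).mono_left (nhdsWithin_mono _ Ioi_subset_Ici_self)
        rwa [hr.zero] at this
      · filter_upwards [self_mem_nhdsWithin] with x hx using hr.pos x hx
    have h₁ : ∀ᶠ x in 𝓝[>] (0 : ℝ), 2 * (M c + 1) / c ≤ M (r x) :=
      (h.tendsto.comp hr₀).eventually_ge_atTop _
    have h₂ : ∀ᶠ x in 𝓝[>] (0 : ℝ), B x < 1 / 2 := by
      have := (hB.cont 0 self_mem_Ici).mono_left (nhdsWithin_mono _ Ioi_subset_Ici_self)
      rw [hB.zero] at this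
      exact this.eventually_lt_const (by norm_num)
    obtain ⟨δ, hδ, hsub⟩ := mem_nhdsGT_iff_exists_Ioc_subset.1 (h₁.and h₂)
    refine ⟨δ, hδ, fun x hx hxδ => ?_⟩
    have key := nonpos_of_hasDerivAt_nonpos (d := fun x => C x - c * B x) (a := 0) (b := δ)
      ((hC.cont.sub (continuousOn_const.mul hB.cont)).mono Icc_subset_Ici_self)
      (by simp [hB.zero, hC.zero])
      (fun t ht hpos => ⟨_, ?_, (hCd t ht.1).sub ((hBd t ht.1).const_mul c)⟩) x ⟨hx.le, hxδ⟩
    · rw [hsdef]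
      exact (div_le_iff₀ (hB.pos x hx)).2 (by linarith)
    · obtain ⟨h₃, h₄⟩ := hsub (Ioo_subset_Ioc_self ht)
      have h₅ : c ≤ s t := (le_div_iff₀ (hB.pos t ht.1)).2 (by linarith)
      have h₆ : M (s t) ≤ M c := h.anti (mem_Ioi.2 hc) (mem_Ioi.2 (hc.trans_le h₅)) h₅
      have h₇ := h.nonneg hc
      have h₈ : 2 * (M c + 1) ≤ M (r t) * c := (div_le_iff₀ hc).1 h₃
      have h₉ : (1 - C t) * M (s t) ≤ M c := by
        nlinarith [hC.pos t ht.1, hC.lt_one t ht.1, h.nonneg (hspos t ht.1)]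
      have h₁₀ : M c + 1 ≤ c * ((1 - B t) * M (r t)) := by
        have : (1 / 2) * (2 * (M c + 1)) ≤ (1 - B t) * (M (r t) * c) :=
          mul_le_mul (by linarith) h₈ (by linarith) (by linarith)
        linarith
      linarith
  have hscont : ContinuousOn s (Ici 0) := by
    intro x hx
    rcases (mem_Ici.1 hx).eq_or_lt with rfl | hx
    · rw [ContinuousWithinAt, hs0, Metric.tendsto_nhdsWithin_nhds]
      intro c hc
      obtain ⟨δ, hδ, hle⟩ := hsmall (c / 2) (half_pos hc)
      refine ⟨δ, hδ, fun t ht htd => ?_⟩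
      rcases (mem_Ici.1 ht).eq_or_lt with rfl | ht
      · rw [hs0, dist_self]
        exact hc
      · rw [Real.dist_eq, sub_zero, abs_of_pos ht] at htd
        rw [Real.dist_eq, sub_zero, abs_of_pos (hspos t ht)]
        linarith [hle t ht htd.le]
    · exact (hsd x hx).continuousAt.continuousWithinAt
  have hs1 : ∀ x, 0 < x → s x < 1 := by
    intro x hx
    rw [← sub_neg]
    refine neg_of_hasDerivAt_neg (d := fun x => s x - 1) (a := 0) (b := x)
      ((hscont.sub continuousOn_const).mono Icc_subset_Ici_self) (by simp [hs0])
      (fun t ht hge => ⟨_, ?_, (hsd t ht.1).sub_const 1⟩) x ⟨hx, le_rfl⟩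
    refine div_neg_of_neg_of_pos ?_ (hB.pos t ht.1)
    simp only [hGdef]
    rw [h.eq_zero _ (sub_nonneg.1 hge), mul_zero, zero_sub, neg_lt_zero]
    exact mul_pos (hspos t ht.1) (mul_pos (by linarith [hB.lt_one t ht.1]) (hMr t ht.1))
  have hrs : ∀ x, 0 < x → r x < s x := by
    intro x hx
    rw [← sub_neg]
    refine neg_of_hasDerivAt_neg (d := fun x => r x - s x) (a := 0) (b := x)
      ((hr.cont.sub hscont).mono Icc_subset_Ici_self) (by simp [hs0, hr.zero])
      (fun t ht hge => ⟨_, ?_, (hr.diff t ht.1).hasDerivAt.sub (hsd t ht.1)⟩) x ⟨hx, le_rfl⟩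
    have hBt := hB.pos t ht.1
    have hst := hspos t ht.1
    have hsr : s t ≤ r t := sub_nonneg.1 hge
    have hM : M (r t) ≤ M (s t) := h.anti (mem_Ioi.2 hst) (mem_Ioi.2 (hst.trans_le hsr)) hsr
    have hrt := hr.pos t ht.1
    have hrt1 := hr.lt_one t ht.1
    have hMrt := hMr t ht.1
    have h₁ : deriv r t ≤ r t * (M (r t) * (1 - r t)) / B t := by
      rw [le_div_iff₀ hBt]
      have h₂ := mul_le_mul_of_nonneg_left (hr.deriv_le t ht.1) hrt.le
      have h₃ : deriv r t * B t = r t * (deriv r t * A t) := by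
        rw [hBr t ht.1]
        ring
      linarith
    have h₄ : r t * (M (r t) * (1 - r t)) < G t := by
      have h₅ : M (r t) * (1 - s t) ≤ G t := by
        have h₆ := mul_le_mul_of_nonneg_left hM (by linarith [hC.lt_one t ht.1] : 0 ≤ 1 - C t)
        have h₇ : M (r t) * (1 - s t) =
            (1 - C t) * M (r t) - s t * ((1 - B t) * M (r t)) := by
          rw [hCs t ht.1]
          ring
        simp only [hGdef]
        linarith
      refine lt_of_lt_of_le ?_ h₅
      have h₈ : 0 < M (r t) * ((1 - r t) * (1 - r t)) :=
        mul_pos hMrt (mul_pos (by linarith) (by linarith))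
      nlinarith
    have h₉ := (div_lt_div_iff_of_pos_right hBt).2 h₄
    linarith
  have hmem : ∀ x, 0 < x → s x ∈ Ioo 0 1 := fun x hx => ⟨hspos x hx, hs1 x hx⟩
  have hrmem : ∀ x, 0 < x → r x ∈ Ioo 0 1 := fun x hx => ⟨hr.pos x hx, hr.lt_one x hx⟩
  have hMle : ∀ x, 0 < x → M (s x) ≤ M (r x) := fun x hx =>
    h.anti (mem_Ioi.2 (hr.pos x hx)) (mem_Ioi.2 (hspos x hx)) (hrs x hx).le
  have hMs : ∀ x, 0 < x → HasDerivAt (fun x => M (s x)) (M' (s x) * (G x / B x)) x :=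
    fun x hx => (h.hasDerivAt _ (hmem x hx)).comp x (hsd x hx)
  have hMrd : ∀ x, 0 < x → HasDerivAt (fun x => M (r x)) (M' (r x) * deriv r x) x :=
    fun x hx => (h.hasDerivAt _ (hrmem x hx)).comp x (hr.diff x hx).hasDerivAt
  have hsc : ContinuousOn s (Ioi 0) := hscont.mono Ioi_subset_Ici_self
  have hrc : ContinuousOn r (Ioi 0) := hr.cont.mono Ioi_subset_Ici_self
  have hBc : ContinuousOn B (Ioi 0) := hB.cont.mono Ioi_subset_Ici_self
  have hCc : ContinuousOn C (Ioi 0) := hC.cont.mono Ioi_subset_Ici_self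
  have hGpos : ∀ x, 0 < x → 0 < G x := fun x hx => by
    refine pos_of_mul_le_deriv (c := fun x => -M (s x) + (1 - C x) * M' (s x) / B x
        - (1 - B x) * M (r x) / B x)
      hscont hs0 hspos hB.pos hsd
      (fun x hx => (((hCd x hx).const_sub 1).mul (hMs x hx)).sub
        ((hsd x hx).mul (((hBd x hx).const_sub 1).mul (hMrd x hx))))
      ?_ (fun x hx => ?_) hx
    · have hB0 : ∀ x ∈ Ioi (0 : ℝ), B x ≠ 0 := fun x hx => (hB.pos x hx).ne'
      have hMsc : ContinuousOn (fun x => M (s x)) (Ioi 0) := h.cont.comp hsc hspos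
      have hMrc : ContinuousOn (fun x => M (r x)) (Ioi 0) := h.cont.comp hrc hr.pos
      have hM'sc : ContinuousOn (fun x => M' (s x)) (Ioi 0) := h.cont_deriv.comp hsc hmem
      exact (hMsc.neg.add (((continuousOn_const.sub hCc).mul hM'sc).div hBc hB0)).sub
        (((continuousOn_const.sub hBc).mul hMrc).div hBc hB0)
    · have hBx := hB.pos x hx
      have h₁ : 0 ≤ s x * ((1 - B x) * M (r x)) * (M (r x) - M (s x)) :=
        mul_nonneg (mul_nonneg (hspos x hx).le (mul_nonneg (by linarith [hB.lt_one x hx])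
          (hMr x hx).le)) (by linarith [hMle x hx])
      have h₂ : 0 ≤ s x * ((1 - B x) * (-M' (r x) * deriv r x)) :=
        mul_nonneg (hspos x hx).le (mul_nonneg (by linarith [hB.lt_one x hx])
          (mul_nonneg (by linarith [h.deriv_nonpos (hrmem x hx)]) (hr.deriv_pos x hx).le))
      have h₃ : (1 - C x) * M (s x) = G x + s x * ((1 - B x) * M (r x)) := by
        simp only [hGdef]
        ring
      rw [h₃]
      have h₄ := add_nonneg h₁ h₂
      rw [← sub_nonneg]
      refine h₄.trans_eq ?_
      ring
  refine ⟨⟨hscont, hs0, hspos, hs1, fun x hx => (hsd x hx).differentiableAt,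
    fun x hx => ?_, fun x hx => ?_⟩, hrs⟩
  · rw [(hsd x hx).deriv]
    exact div_pos (hGpos x hx) (hB.pos x hx)
  · rw [(hsd x hx).deriv, div_mul_cancel₀ _ (hB.pos x hx).ne']
    have h₁ : 0 ≤ s x * (1 - B x) * (M (r x) - M (s x)) :=
      mul_nonneg (mul_nonneg (hspos x hx).le (by linarith [hB.lt_one x hx]))
        (by linarith [hMle x hx])
    simp only [hGdef]
    rw [hCs x hx]
    linarith

end IsRate

/-- An effectiveness function `P` on `[0,1]` with derivative `P'` on `(0,1)`. -/
structure IsEffectiveness (P P' : ℝ → ℝ) : Prop where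
  cont : ContinuousOn P (Icc 0 1)
  hasDerivAt : ∀ t ∈ Ioo (0 : ℝ) 1, HasDerivAt P (P' t) t
  cont_deriv : ContinuousOn P' (Ioo 0 1)
  deriv_nonneg : ∀ t ∈ Ioo (0 : ℝ) 1, 0 ≤ P' t
  zero : P 0 = 0
  one : P 1 = 1
  lt_one : ∀ t ∈ Ico (0 : ℝ) 1, P t < 1

/-- `ψ` is a monotone extension of the inverse of `1 - P` to the real line. -/
structure IsComplInverse (P P' ψ : ℝ → ℝ) : Prop where
  continuous : Continuous ψ
  anti : Antitone ψ
  mem : ∀ s, ψ s ∈ Icc (0 : ℝ) 1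
  apply_self : ∀ s ∈ Icc (0 : ℝ) 1, P (ψ s) = 1 - s
  self_apply : ∀ t ∈ Icc (0 : ℝ) 1, ψ (1 - P t) = t
  zero : ψ 0 = 1
  eq_zero : ∀ s, 1 ≤ s → ψ s = 0
  lt_one : ∀ s, 0 < s → ψ s < 1
  mem_Ioo : ∀ s ∈ Ioo (0 : ℝ) 1, ψ s ∈ Ioo (0 : ℝ) 1
  hasDerivAt : ∀ s ∈ Ioo (0 : ℝ) 1, HasDerivAt ψ (-(P' (ψ s))⁻¹) s

lemma IsEffectiveness.monotoneOn {P P' : ℝ → ℝ} (h : IsEffectiveness P P') :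
    MonotoneOn P (Icc 0 1) := by
  apply monotoneOn_of_deriv_nonneg (convex_Icc _ _) h.cont
  · rw [interior_Icc]
    exact fun t ht => (h.hasDerivAt t ht).differentiableAt.differentiableWithinAt
  · rw [interior_Icc]
    intro t ht
    rw [(h.hasDerivAt t ht).deriv]
    exact h.deriv_nonneg t ht

lemma IsEffectiveness.exists_isComplInverse {P P' : ℝ → ℝ} (h : IsEffectiveness P P')
    (hP' : ∀ t ∈ Ioo (0 : ℝ) 1, 0 < P' t) : ∃ ψ, IsComplInverse P P' ψ := by
  have hmono : StrictMonoOn P (Icc 0 1) := by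
    apply strictMonoOn_of_deriv_pos (convex_Icc _ _) h.cont
    rw [interior_Icc]
    intro t ht
    rw [(h.hasDerivAt t ht).deriv]
    exact hP' t ht
  have h0 : (0 : ℝ) ∈ Icc (0 : ℝ) 1 := ⟨le_rfl, zero_le_one⟩
  have h1 : (1 : ℝ) ∈ Icc (0 : ℝ) 1 := ⟨zero_le_one, le_rfl⟩
  have hmaps : ∀ t ∈ Icc (0 : ℝ) 1, P t ∈ Icc (0 : ℝ) 1 := fun t ht =>
    ⟨h.zero ▸ hmono.monotoneOn h0 ht ht.1, h.one ▸ hmono.monotoneOn ht h1 ht.2⟩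
  set f : Icc (0 : ℝ) 1 → Icc (0 : ℝ) 1 := fun t => ⟨P t, hmaps t t.2⟩ with hf
  have hfmono : StrictMono f := fun s t hst => hmono s.2 t.2 hst
  have hfsurj : Function.Surjective f := by
    rintro ⟨u, hu⟩
    obtain ⟨t, ht, htu⟩ := intermediate_value_Icc zero_le_one h.cont
      (show u ∈ Icc (P 0) (P 1) by rwa [h.zero, h.one])
    exact ⟨⟨t, ht⟩, Subtype.ext htu⟩
  set e := hfmono.orderIsoOfSurjective f hfsurj with he
  set ψ : ℝ → ℝ := fun s => e.symm (projIcc 0 1 zero_le_one (1 - s)) with hψ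
  have hcont : Continuous ψ := continuous_subtype_val.comp
    (e.symm.continuous.comp (continuous_projIcc.comp (continuous_const.sub continuous_id)))
  have happ : ∀ s ∈ Icc (0 : ℝ) 1, P (ψ s) = 1 - s := by
    intro s hs
    have h₁ : e (e.symm (projIcc 0 1 zero_le_one (1 - s))) = projIcc 0 1 zero_le_one (1 - s) :=
      e.apply_symm_apply _
    exact (congrArg Subtype.val h₁).trans (by
      rw [projIcc_of_mem zero_le_one (show 1 - s ∈ Icc (0 : ℝ) 1 from
        ⟨by linarith [hs.2], by linarith [hs.1]⟩)])
  have hmem : ∀ s, ψ s ∈ Icc (0 : ℝ) 1 := fun s => Subtype.coe_prop _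
  have hinv : ∀ t ∈ Icc (0 : ℝ) 1, ψ (1 - P t) = t := by
    intro t ht
    have hPt := hmaps t ht
    refine hmono.injOn (hmem _) ht ?_
    rw [happ _ ⟨by linarith [hPt.2], by linarith [hPt.1]⟩, sub_sub_cancel]
  have hanti : Antitone ψ := fun s t hst =>
    Subtype.coe_le_coe.2 (e.symm.monotone (monotone_projIcc _ (by linarith)))
  have hzero : ψ 0 = 1 := by
    have := hinv 1 h1
    rwa [h.one, sub_self] at this
  have hone : ψ 1 = 0 := by
    have := hinv 0 h0
    rwa [h.zero, sub_zero] at this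
  have hlt : ∀ s, 0 < s → ψ s < 1 := by
    intro s hs
    have hm : min s 1 ∈ Icc (0 : ℝ) 1 := ⟨le_min hs.le zero_le_one, min_le_right _ _⟩
    refine (hanti (min_le_left s 1)).trans_lt (lt_of_le_of_ne (hmem _).2 fun heq => ?_)
    have h₁ := happ _ hm
    rw [heq, h.one] at h₁
    have : 0 < min s 1 := lt_min hs one_pos
    linarith
  have hIoo : ∀ s ∈ Ioo (0 : ℝ) 1, ψ s ∈ Ioo (0 : ℝ) 1 := by
    refine fun s hs => ⟨lt_of_le_of_ne (hmem s).1 fun heq => ?_, hlt s hs.1⟩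
    have h₁ := happ s (Ioo_subset_Icc_self hs)
    rw [← heq, h.zero] at h₁
    linarith [hs.2]
  refine ⟨ψ, hcont, hanti, hmem, happ, hinv, hzero, fun s hs => ?_, hlt, hIoo, fun s hs => ?_⟩
  · exact le_antisymm (hone ▸ hanti hs) (hmem s).1
  · rw [← inv_neg]
    refine HasDerivAt.of_local_left_inverse (f := fun t => 1 - P t) hcont.continuousAt
      ((h.hasDerivAt _ (hIoo s hs)).const_sub 1) (neg_ne_zero.2 (hP' _ (hIoo s hs)).ne') ?_
    filter_upwards [Icc_mem_nhds hs.1 hs.2] with u hu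
    rw [happ u hu, sub_sub_cancel]

namespace IsComplInverse

variable {P₁ P₁' P₂ P₂' ψ : ℝ → ℝ}

lemma lt_of_lt (hψ : IsComplInverse P₂ P₂' ψ) {s t : ℝ} (hs : 0 ≤ s) (hst : s < t)
    (ht : t ≤ 1) : ψ t < ψ s := by
  refine lt_of_le_of_ne (hψ.anti hst.le) fun heq => hst.ne ?_
  have h₁ := hψ.apply_self t ⟨by linarith, ht⟩
  rw [heq, hψ.apply_self s ⟨hs, by linarith⟩] at h₁
  linarith

/-- In the coordinate `s = 1 - P₂ t` the function `-log (1 - P₁ t)` is a rate function. -/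
lemma isRate (hψ : IsComplInverse P₂ P₂' ψ) (h₁ : IsEffectiveness P₁ P₁')
    (h₂ : IsEffectiveness P₂ P₂') (hP₂' : ∀ t ∈ Ioo (0 : ℝ) 1, 0 < P₂' t) :
    IsRate (fun s => -Real.log (1 - P₁ (ψ s)))
      (fun s => P₁' (ψ s) / (1 - P₁ (ψ s)) * -(P₂' (ψ s))⁻¹) := by
  have hlt : ∀ s, 0 < s → 0 < 1 - P₁ (ψ s) := fun s hs =>
    sub_pos.2 (h₁.lt_one _ ⟨(hψ.mem s).1, hψ.lt_one s hs⟩)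
  have hPψ : Continuous fun s => P₁ (ψ s) :=
    h₁.cont.comp_continuous hψ.continuous hψ.mem
  have hψc : ContinuousOn ψ (Ioo 0 1) := hψ.continuous.continuousOn
  refine ⟨?_, ?_, ?_, ?_, ?_, ?_⟩
  · intro s hs t ht hst
    have := h₁.monotoneOn (hψ.mem t) (hψ.mem s) (hψ.anti hst)
    exact neg_le_neg (Real.log_le_log (hlt s hs) (by linarith))
  · exact ((continuous_const.sub hPψ).continuousOn.log fun s hs => (hlt s hs).ne').neg
  · intro s hs
    simp [hψ.eq_zero s hs, h₁.zero]
  · rw [tendsto_neg_atTop_iff]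
    refine Real.tendsto_log_nhdsGT_zero.comp (tendsto_nhdsWithin_iff.2 ⟨?_, ?_⟩)
    · have := (continuous_const.sub hPψ).tendsto (f := fun s => 1 - P₁ (ψ s)) 0
      rw [hψ.zero, h₁.one, sub_self] at this
      exact this.mono_left nhdsWithin_le_nhds
    · filter_upwards [self_mem_nhdsWithin] with s hs using hlt s hs
  · intro s hs
    have hd := (h₁.hasDerivAt _ (hψ.mem_Ioo s hs)).comp s (hψ.hasDerivAt s hs)
    refine ((hd.const_sub 1).log (hlt s hs.1).ne').neg.congr_deriv ?_
    simp only [Function.comp_apply]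
    ring
  · exact ((h₁.cont_deriv.comp hψc hψ.mem_Ioo).div (continuous_const.sub hPψ).continuousOn
      fun s hs => (hlt s hs.1).ne').mul
      ((h₂.cont_deriv.comp hψc hψ.mem_Ioo).inv₀ fun s hs => (hP₂' _ (hψ.mem_Ioo s hs)).ne').neg

end IsComplInverse

lemma contDiffOn_one_of_hasDerivAt {f f' : ℝ → ℝ} {s : Set ℝ} (hs : IsOpen s)
    (hf : ∀ x ∈ s, HasDerivAt f (f' x) x) (hf' : ContinuousOn f' s) : ContDiffOn ℝ 1 f s := by
  rw [show (1 : WithTop ℕ∞) = 0 + 1 from (zero_add _).symm,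
    contDiffOn_succ_iff_deriv_of_isOpen hs]
  refine ⟨fun x hx => (hf x hx).differentiableAt.differentiableWithinAt, by simp, ?_⟩
  exact contDiffOn_zero.2 (hf'.congr fun x hx => (hf x hx).deriv)

lemma IsNext.congr {M A A' B : ℝ → ℝ} (hB : IsNext M A B) (hA : ∀ x, 0 < x → A x = A' x) :
    IsNext M A' B :=
  ⟨hB.cont, hB.zero, hB.pos, hB.lt_one, fun x hx => hA x hx ▸ hB.hasDerivAt x hx⟩

lemma IsNext.integral_eq {M M' A B : ℝ → ℝ} (hB : IsNext M A B) (h : IsRate M M')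
    (hA : ∀ x, 0 < x → 0 < A x) {x : ℝ} (hx : 0 < x) :
    ∫ β in (0 : ℝ)..x, M (B β / A β) = -Real.log (1 - B x) := by
  have hpos : ∀ β ∈ Icc 0 x, 0 < 1 - B β := by
    intro β hβ
    rcases hβ.1.eq_or_lt with rfl | h0
    · simp [hB.zero]
    · exact sub_pos.2 (hB.lt_one β h0)
  have hcont : ContinuousOn (fun β => -Real.log (1 - B β)) (Icc 0 x) :=
    ((continuousOn_const.sub (hB.cont.mono Icc_subset_Ici_self)).log
      fun β hβ => (hpos β hβ).ne').neg
  have hd : ∀ β ∈ Ioo 0 x, HasDerivAt (fun β => -Real.log (1 - B β)) (M (B β / A β)) β := by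
    intro β hβ
    have hp := hpos β (Ioo_subset_Icc_self hβ)
    refine (((hB.hasDerivAt β hβ.1).const_sub 1).log hp.ne').neg.congr_deriv ?_
    field_simp
  rw [intervalIntegral.integral_eq_sub_of_hasDerivAt_of_le hx.le hcont hd]
  · simp [hB.zero]
  · rw [intervalIntegrable_iff_integrableOn_Ioc_of_le hx.le]
    exact intervalIntegral.integrableOn_deriv_of_nonneg hcont hd
      fun β hβ => h.nonneg (div_pos (hB.pos β hβ.1) (hA β hβ.1))

/-- The sequence `Q` obtained from the constant function `1` by successively solving the
equations in `IsNext`. -/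
structure IsIterate (M : ℝ → ℝ) (Q : ℕ → ℝ → ℝ) : Prop where
  zero : Q 0 = fun _ => 1
  next : ∀ k, IsNext M (Q k) (Q (k + 1))

lemma IsRate.exists_isIterate {M M' : ℝ → ℝ} (h : IsRate M M') : ∃ Q, IsIterate M Q := by
  let V := {A : ℝ → ℝ // ContinuousOn A (Ioi 0) ∧ ∀ x, 0 < x → 0 < A x ∧ A x ≤ 1}
  have hex : ∀ A : V, ∃ B : V, IsNext M A B := by
    rintro ⟨A, hAc, hA⟩
    obtain ⟨B, hB⟩ := h.exists_isNext hAc hA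
    exact ⟨⟨B, hB.cont.mono Ioi_subset_Ici_self,
      fun x hx => ⟨hB.pos x hx, (hB.lt_one x hx).le⟩⟩, hB⟩
  choose F hF using hex
  let one : V := ⟨fun _ => 1, continuousOn_const, fun _ _ => ⟨one_pos, le_rfl⟩⟩
  refine ⟨fun k => (F^[k] one).1, rfl, fun k => ?_⟩
  simp only [Function.iterate_succ_apply']
  exact hF _

namespace IsIterate

variable {M M' : ℝ → ℝ} {Q R : ℕ → ℝ → ℝ}

lemma cont (hQ : IsIterate M Q) (k : ℕ) : ContinuousOn (Q k) (Ici 0) := by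
  cases k with
  | zero => rw [hQ.zero]; exact continuousOn_const
  | succ k => exact (hQ.next k).cont

lemma pos (hQ : IsIterate M Q) (k : ℕ) {x : ℝ} (hx : 0 < x) : 0 < Q k x := by
  cases k with
  | zero => simp [hQ.zero]
  | succ k => exact (hQ.next k).pos x hx

lemma eq (hQ : IsIterate M Q) (hR : IsIterate M R) (h : IsRate M M') (k : ℕ) :
    ∀ x, 0 < x → R k x = Q k x := by
  induction k with
  | zero => simp [hQ.zero, hR.zero]
  | succ k ih =>
    exact fun x hx => h.isNext_unique (fun x hx => hQ.pos k hx) ((hR.next k).congr ih)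
      (hQ.next k) hx.le

lemma isGood (hQ : IsIterate M Q) (h : IsRate M M') (k : ℕ) :
    IsGood M (Q k) (fun x => Q (k + 1) x / Q k x) := by
  induction k with
  | zero =>
    have h₀ := hQ.next 0
    rw [hQ.zero] at h₀ ⊢
    exact h.isGood_of_isNext_one h₀
  | succ k ih => exact (h.isGood_succ (fun x hx => hQ.pos k hx) (hQ.next k) (hQ.next (k + 1)) ih).1

lemma ratio_lt (hQ : IsIterate M Q) (h : IsRate M M') (k : ℕ) {x : ℝ} (hx : 0 < x) :
    Q (k + 1) x / Q k x < Q (k + 2) x / Q (k + 1) x :=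
  (h.isGood_succ (fun _ hx => hQ.pos k hx) (hQ.next k) (hQ.next (k + 1))
    (hQ.isGood h k)).2 x hx

lemma hasDerivAt (hQ : IsIterate M Q) (k : ℕ) {x : ℝ} (hx : 0 < x) :
    HasDerivAt (Q k) ((1 - Q k x) * M (Q k x / Q (k - 1) x)) x := by
  cases k with
  | zero => simpa [hQ.zero] using hasDerivAt_const x (1 : ℝ)
  | succ k => exact (hQ.next k).hasDerivAt x hx

lemma ratio_pos (hQ : IsIterate M Q) (k l : ℕ) {x : ℝ} (hx : 0 < x) : 0 < Q k x / Q l x :=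
  div_pos (hQ.pos k hx) (hQ.pos l hx)

/-- The derivative of the ratio `Q (k + 1) / Q k`. -/
lemma hasDerivAt_ratio (hQ : IsIterate M Q) (k : ℕ) {x : ℝ} (hx : 0 < x) :
    HasDerivAt (fun x => Q (k + 1) x / Q k x)
      (((1 - Q (k + 1) x) * M (Q (k + 1) x / Q k x)
        - Q (k + 1) x / Q k x * ((1 - Q k x) * M (Q k x / Q (k - 1) x))) / Q k x) x := by
  have hp := hQ.pos k hx
  refine ((hQ.hasDerivAt (k + 1) hx).div (hQ.hasDerivAt k hx) hp.ne').congr_deriv ?_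
  rw [Nat.add_sub_cancel]
  field_simp

lemma continuousOn_ratio (hQ : IsIterate M Q) (k l : ℕ) :
    ContinuousOn (fun x => Q k x / Q l x) (Ioi 0) :=
  ((hQ.cont k).mono Ioi_subset_Ici_self).div ((hQ.cont l).mono Ioi_subset_Ici_self)
    fun _ hx => (hQ.pos l hx).ne'

lemma continuousOn_deriv_ratio (hQ : IsIterate M Q) (h : IsRate M M') (k : ℕ) :
    ContinuousOn (fun x => ((1 - Q (k + 1) x) * M (Q (k + 1) x / Q k x)
        - Q (k + 1) x / Q k x * ((1 - Q k x) * M (Q k x / Q (k - 1) x))) / Q k x) (Ioi 0) := by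
  have hc : ∀ k, ContinuousOn (Q k) (Ioi 0) := fun k => (hQ.cont k).mono Ioi_subset_Ici_self
  have hM : ∀ k l, ContinuousOn (fun x => M (Q k x / Q l x)) (Ioi 0) := fun k l =>
    h.cont.comp (hQ.continuousOn_ratio k l) fun x hx => hQ.ratio_pos k l hx
  exact (((continuousOn_const.sub (hc _)).mul (hM _ _)).sub ((hQ.continuousOn_ratio _ _).mul
    ((continuousOn_const.sub (hc _)).mul (hM _ _)))).div (hc k) fun x hx => (hQ.pos k hx).ne'

end IsIterate

/-- The sequence `T k = ψ (Q k / Q (k - 1))` associated with `Q`. -/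
noncomputable def strategySeq (ψ : ℝ → ℝ) (Q : ℕ → ℝ → ℝ) (k : ℕ) (x : ℝ) : ℝ :=
  ψ (Q k x / Q (k - 1) x)

namespace IsComplInverse

variable {P₁ P₂ P₂' ψ M M' : ℝ → ℝ} {Q : ℕ → ℝ → ℝ}

lemma one_sub_strategySeq (hψ : IsComplInverse P₂ P₂' ψ) (hQ : IsIterate M Q)
    (h : IsRate M M') (k : ℕ) {x : ℝ} (hx : 0 < x) :
    1 - P₂ (strategySeq ψ Q (k + 1) x) = Q (k + 1) x / Q k x := by
  have hr := hQ.isGood h k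
  rw [strategySeq, Nat.add_sub_cancel, hψ.apply_self _ ⟨(hr.pos x hx).le, (hr.lt_one x hx).le⟩]
  ring

lemma prod_strategySeq (hψ : IsComplInverse P₂ P₂' ψ) (hQ : IsIterate M Q)
    (h : IsRate M M') (k : ℕ) {x : ℝ} (hx : 0 < x) :
    ∏ i ∈ Finset.Icc 1 k, (1 - P₂ (strategySeq ψ Q i x)) = Q k x := by
  induction k with
  | zero => simp [hQ.zero]
  | succ k ih =>
    rw [Finset.prod_Icc_succ_top (by omega), ih, hψ.one_sub_strategySeq hQ h k hx,
      mul_div_cancel₀ _ (hQ.pos k hx).ne']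

lemma hasDerivAt_strategySeq (hψ : IsComplInverse P₂ P₂' ψ) (hQ : IsIterate M Q)
    (h : IsRate M M') (k : ℕ) {x : ℝ} (hx : 0 < x) :
    HasDerivAt (strategySeq ψ Q (k + 1))
      (-(P₂' (ψ (Q (k + 1) x / Q k x)))⁻¹ *
        (((1 - Q (k + 1) x) * M (Q (k + 1) x / Q k x)
        - Q (k + 1) x / Q k x * ((1 - Q k x) * M (Q k x / Q (k - 1) x))) / Q k x)) x :=
  have hr := hQ.isGood h k
  (hψ.hasDerivAt _ ⟨hr.pos x hx, hr.lt_one x hx⟩).comp x (hQ.hasDerivAt_ratio k hx)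

lemma isClassT_strategySeq (hψ : IsComplInverse P₂ P₂' ψ) (hQ : IsIterate M Q)
    (h : IsRate M M') (hP₂' : ∀ t ∈ Ioo (0 : ℝ) 1, 0 < P₂' t)
    (hP₂'c : ContinuousOn P₂' (Ioo 0 1)) : IsClassT (strategySeq ψ Q) := by
  intro k hk
  obtain ⟨k, rfl⟩ := Nat.exists_eq_add_of_le' hk
  have hr := hQ.isGood h k
  have hmem : ∀ x, 0 < x → ψ (Q (k + 1) x / Q k x) ∈ Ioo (0 : ℝ) 1 := fun x hx =>
    hψ.mem_Ioo _ ⟨hr.pos x hx, hr.lt_one x hx⟩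
  have hzero : strategySeq ψ Q (k + 1) 0 = 1 := by
    have : Q (k + 1) 0 / Q k 0 = 0 := hr.zero
    simp [strategySeq, this, hψ.zero]
  refine ⟨hψ.continuous.comp_continuousOn hr.cont,
    contDiffOn_one_of_hasDerivAt isOpen_Ioi
      (fun x hx => hψ.hasDerivAt_strategySeq hQ h k hx) ?_, fun x hx => ?_, fun x hx => ?_,
    fun x hx => ?_, hzero⟩
  · have hc : ContinuousOn (fun x => ψ (Q (k + 1) x / Q k x)) (Ioi 0) :=
      hψ.continuous.comp_continuousOn (hr.cont.mono Ioi_subset_Ici_self)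
    exact ((hP₂'c.comp hc hmem).inv₀ fun x hx => (hP₂' _ (hmem x hx)).ne').neg.mul
      (hQ.continuousOn_deriv_ratio h k)
  · rcases hx.eq_or_lt with rfl | hx
    · simp [hzero]
    · exact ⟨(hmem x hx).1, (hmem x hx).2.le⟩
  · rw [(hψ.hasDerivAt_strategySeq hQ h k hx).deriv, ← (hQ.hasDerivAt_ratio k hx).deriv]
    exact mul_neg_of_neg_of_pos (neg_lt_zero.2 (inv_pos.2 (hP₂' _ (hmem x hx))))
      (hr.deriv_pos x hx)
  · exact hψ.lt_of_lt (hr.pos x hx).le (hQ.ratio_lt h k hx)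
      ((hQ.isGood h (k + 1)).lt_one x hx).le

lemma eqT1_strategySeq (hψ : IsComplInverse P₂ P₂' ψ)
    (hQ : IsIterate (fun s => -Real.log (1 - P₁ (ψ s))) Q)
    (h : IsRate (fun s => -Real.log (1 - P₁ (ψ s))) M') {x : ℝ} (hx : 0 < x) {k : ℕ}
    (hk : 1 ≤ k) : EqT1 P₁ P₂ (strategySeq ψ Q) x k := by
  obtain ⟨k, rfl⟩ := Nat.exists_eq_add_of_le' hk
  have hint := (hQ.next k).integral_eq h (fun _ hx => hQ.pos k hx) hx
  rw [intervalIntegral.integral_neg, neg_inj] at hint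
  rw [EqT1, hψ.prod_strategySeq hQ h _ hx]
  simp only [strategySeq, Nat.add_sub_cancel]
  rw [hint, Real.exp_log (sub_pos.2 ((hQ.next k).lt_one x hx))]
  ring

lemma deriv_strategySeq (hψ : IsComplInverse P₂ P₂' ψ)
    (hQ : IsIterate (fun s => -Real.log (1 - P₁ (ψ s))) Q)
    (h : IsRate (fun s => -Real.log (1 - P₁ (ψ s))) M') {x : ℝ} (hx : 0 < x) {k : ℕ}
    (hk : 1 ≤ k) : deriv (strategySeq ψ Q k) x =
      difeqRHS (fun t => 1 - P₁ t) (fun t => 1 - P₂ t) (fun t => -P₂' t)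
        (strategySeq ψ Q) k x := by
  obtain ⟨k, rfl⟩ := Nat.exists_eq_add_of_le' hk
  rw [(hψ.hasDerivAt_strategySeq hQ h k hx).deriv, difeqRHS, Nat.add_sub_cancel,
    hψ.prod_strategySeq hQ h _ hx, hψ.prod_strategySeq hQ h _ hx,
    hψ.one_sub_strategySeq hQ h k hx]
  simp only [strategySeq, Nat.add_sub_cancel, div_eq_mul_inv, mul_inv, inv_neg]
  ring

/-- A solution of (eqT1) in the class `𝒯` yields solutions of the equations in `IsNext`. -/
lemma isIterate_of_eqT1 {S : ℕ → ℝ → ℝ} (hψ : IsComplInverse P₂ P₂' ψ)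
    {P₁' : ℝ → ℝ} (h₁ : IsEffectiveness P₁ P₁') (h₂ : IsEffectiveness P₂ P₂')
    (hS : IsClassT S) (hS' : ∀ x, 0 < x → ∀ k, 1 ≤ k → EqT1 P₁ P₂ S x k)
    (hS₁ : ∀ k, 1 ≤ k → ∀ x, 0 < x → S k x < 1) :
    IsIterate (fun s => -Real.log (1 - P₁ (ψ s)))
      (fun k x => ∏ i ∈ Finset.Icc 1 k, (1 - P₂ (S i x))) := by
  have hmem : ∀ k, 1 ≤ k → ∀ x, 0 ≤ x → S k x ∈ Icc (0 : ℝ) 1 := fun k hk x hx =>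
    ⟨((hS k hk).2.2.1 x hx).1.le, ((hS k hk).2.2.1 x hx).2⟩
  have hlt : ∀ {P P' : ℝ → ℝ}, IsEffectiveness P P' → ∀ k, 1 ≤ k → ∀ x, 0 < x →
      0 < 1 - P (S k x) := fun h k hk x hx =>
    sub_pos.2 (h.lt_one _ ⟨(hmem k hk x hx.le).1, hS₁ k hk x hx⟩)
  have hcont : ∀ {P P' : ℝ → ℝ}, IsEffectiveness P P' → ∀ k, 1 ≤ k →
      ContinuousOn (fun x => 1 - P (S k x)) (Ici 0) := fun h k hk =>
    continuousOn_const.sub (h.cont.comp (hS k hk).1 (hmem k hk))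
  set R : ℕ → ℝ → ℝ := fun k x => ∏ i ∈ Finset.Icc 1 k, (1 - P₂ (S i x)) with hR
  have hsucc : ∀ k x, R (k + 1) x = R k x * (1 - P₂ (S (k + 1) x)) := fun k x =>
    Finset.prod_Icc_succ_top (by omega) _
  have hpos : ∀ k x, 0 < x → 0 < R k x := fun k x hx =>
    Finset.prod_pos fun i hi => hlt h₂ i (Finset.mem_Icc.1 hi).1 x hx
  refine ⟨by simp [hR], fun k => ?_⟩
  have hk : 1 ≤ k + 1 := by omega
  set f : ℝ → ℝ := fun x => Real.log (1 - P₁ (S (k + 1) x)) with hf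
  have hfc : ContinuousOn f (Ioi 0) :=
    ((hcont h₁ _ hk).mono Ioi_subset_Ici_self).log fun x hx => (hlt h₁ _ hk x hx).ne'
  have heq : ∀ x, 0 < x → R (k + 1) x = 1 - Real.exp (∫ β in (0 : ℝ)..x, f β) :=
    fun x hx => by linarith [show _ + R (k + 1) x = 1 from hS' x hx (k + 1) hk]
  have hint : ∀ x, 0 < x → IntervalIntegrable f volume 0 x := by
    intro x hx
    by_contra hni
    have h₃ := hpos (k + 1) x hx
    rw [heq x hx, intervalIntegral.integral_undef hni] at h₃
    simp at h₃
  refine ⟨?_, ?_, hpos (k + 1), fun x hx => ?_, fun x hx => ?_⟩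
  · exact continuousOn_finsetProd _ fun i hi => hcont h₂ i (Finset.mem_Icc.1 hi).1
  · rw [hsucc, (hS _ hk).2.2.2.2.2, h₂.one]
    simp
  · rw [heq x hx]
    linarith [Real.exp_pos (∫ β in (0 : ℝ)..x, f β)]
  · have hd : HasDerivAt (fun u => ∫ β in (0 : ℝ)..u, f β) (f x) x :=
      intervalIntegral.integral_hasDerivAt_right (hint x hx)
        (hfc.stronglyMeasurableAtFilter isOpen_Ioi x hx) (hfc.continuousAt (Ioi_mem_nhds hx))
    have hd' : HasDerivAt (R (k + 1)) (-(Real.exp (∫ β in (0 : ℝ)..x, f β) * f x)) x :=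
      (hd.exp.const_sub 1).congr_of_eventuallyEq
        (by filter_upwards [Ioi_mem_nhds hx] with u hu using heq u hu)
    refine hd'.congr_deriv ?_
    rw [hsucc, mul_div_cancel_left₀ _ (hpos k x hx).ne', hψ.self_apply _ (hmem _ hk x hx.le),
      ← hsucc, heq x hx]
    ring

lemma eq_strategySeq {S : ℕ → ℝ → ℝ} (hψ : IsComplInverse P₂ P₂' ψ)
    {P₁' : ℝ → ℝ} (h₁ : IsEffectiveness P₁ P₁') (h₂ : IsEffectiveness P₂ P₂')
    (hQ : IsIterate (fun s => -Real.log (1 - P₁ (ψ s))) Q)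
    (h : IsRate (fun s => -Real.log (1 - P₁ (ψ s))) M')
    (hS : IsClassT S) (hS' : ∀ x, 0 < x → ∀ k, 1 ≤ k → EqT1 P₁ P₂ S x k)
    {k : ℕ} (hk : 1 ≤ k) {x : ℝ} (hx : 0 < x) : S k x = strategySeq ψ Q k x := by
  have hS₁ : ∀ k, 1 ≤ k → ∀ x, 0 < x → S k x < 1 := by
    intro k hk x hx
    obtain ⟨hc, -, -, hd, -, h0⟩ := hS k hk
    have := strictAntiOn_of_deriv_neg (convex_Ici 0) hc (by rwa [interior_Ici])
      (mem_Ici.2 le_rfl) (mem_Ici.2 hx.le) hx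
    rwa [h0] at this
  have heq := hQ.eq (hψ.isIterate_of_eqT1 h₁ h₂ hS hS' hS₁) h
  have hp := hQ.pos (k - 1) hx
  obtain ⟨k, rfl⟩ := Nat.exists_eq_add_of_le' hk
  rw [strategySeq, ← heq (k + 1) x hx, ← heq (k + 1 - 1) x hx, Nat.add_sub_cancel,
    Finset.prod_Icc_succ_top (by omega), mul_div_cancel_left₀, hψ.self_apply]
  · exact ⟨((hS _ hk).2.2.1 x hx.le).1.le, ((hS _ hk).2.2.1 x hx.le).2⟩
  · rw [Nat.add_sub_cancel] at hp
    rw [heq k x hx]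
    exact hp.ne'

end IsComplInverse

/-- Theorem 2, essential part. Suppose the effectiveness functions
`P₁, P₂ : [0,1] → [0,1]` are continuously differentiable on `(0,1]`, with
`P_j 0 = 0`, `P_j 1 = 1`, `P_j t < 1` for `t < 1`, `P₁' ≥ 0` and `P₂' > 0`.  Then
there exists exactly one sequence `T ∈ 𝒯` satisfying (eqT1) at every pair `(x,k)`
with `x > 0`, `k ≥ 1`, namely the solution of the ODE system (difeq) (with
`p = 1 - P₁`, `q = 1 - P₂`) with initial conditions `T_k 0 = 1`. -/
theorem exists_unique_classT_eqT1
    (P₁ P₂ P₁' P₂' : ℝ → ℝ)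
    (hP₁c : ContinuousOn P₁ (Icc 0 1)) (hP₂c : ContinuousOn P₂ (Icc 0 1))
    (hP₁d : ∀ t ∈ Ioc (0 : ℝ) 1, HasDerivWithinAt P₁ (P₁' t) (Ioc 0 1) t)
    (hP₂d : ∀ t ∈ Ioc (0 : ℝ) 1, HasDerivWithinAt P₂ (P₂' t) (Ioc 0 1) t)
    (hP₁'c : ContinuousOn P₁' (Ioc 0 1)) (hP₂'c : ContinuousOn P₂' (Ioc 0 1))
    (hP₁0 : P₁ 0 = 0) (hP₂0 : P₂ 0 = 0) (hP₁1 : P₁ 1 = 1) (hP₂1 : P₂ 1 = 1)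
    (hP₁lt : ∀ t ∈ Ico (0 : ℝ) 1, P₁ t < 1) (hP₂lt : ∀ t ∈ Ico (0 : ℝ) 1, P₂ t < 1)
    (hP₁' : ∀ t ∈ Ioc (0 : ℝ) 1, 0 ≤ P₁' t)
    (hP₂' : ∀ t ∈ Ioc (0 : ℝ) 1, 0 < P₂' t) :
    ∃ T : ℕ → ℝ → ℝ,
      (IsClassT T ∧
        (∀ x > (0 : ℝ), ∀ k, 1 ≤ k → EqT1 P₁ P₂ T x k) ∧
        (∀ x > (0 : ℝ), ∀ k, 1 ≤ k →
          deriv (T k) x =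
            difeqRHS (fun t => 1 - P₁ t) (fun t => 1 - P₂ t)
              (fun t => -P₂' t) T k x)) ∧
      ∀ S : ℕ → ℝ → ℝ, IsClassT S →
        (∀ x > (0 : ℝ), ∀ k, 1 ≤ k → EqT1 P₁ P₂ S x k) →
        ∀ k, 1 ≤ k → ∀ x, (0 : ℝ) ≤ x → S k x = T k x := by
  have h₁ : IsEffectiveness P₁ P₁' :=
    ⟨hP₁c, fun t ht => (hP₁d t (Ioo_subset_Ioc_self ht)).hasDerivAt (Ioc_mem_nhds ht.1 ht.2),
      hP₁'c.mono Ioo_subset_Ioc_self, fun t ht => hP₁' t (Ioo_subset_Ioc_self ht),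
      hP₁0, hP₁1, hP₁lt⟩
  have hpos : ∀ t ∈ Ioo (0 : ℝ) 1, 0 < P₂' t := fun t ht => hP₂' t (Ioo_subset_Ioc_self ht)
  have h₂ : IsEffectiveness P₂ P₂' :=
    ⟨hP₂c, fun t ht => (hP₂d t (Ioo_subset_Ioc_self ht)).hasDerivAt (Ioc_mem_nhds ht.1 ht.2),
      hP₂'c.mono Ioo_subset_Ioc_self, fun t ht => (hpos t ht).le, hP₂0, hP₂1, hP₂lt⟩
  obtain ⟨ψ, hψ⟩ := h₂.exists_isComplInverse hpos
  have hM := hψ.isRate h₁ h₂ hpos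
  obtain ⟨Q, hQ⟩ := hM.exists_isIterate
  have hT := hψ.isClassT_strategySeq hQ hM hpos h₂.cont_deriv
  refine ⟨strategySeq ψ Q, ⟨hT, fun x hx k hk => hψ.eqT1_strategySeq hQ hM hx hk,
    fun x hx k hk => hψ.deriv_strategySeq hQ hM hx hk⟩, fun S hS hS' k hk x hx => ?_⟩
  rcases hx.eq_or_lt with rfl | hx
  · rw [(hS k hk).2.2.2.2.2, (hT k hk).2.2.2.2.2]
  · exact hψ.eq_strategySeq h₁ h₂ hQ hM hS hS' hk hx
end

section
/- Let k≥2 and let T₁,…,T_{k−1} be functions on [0,∞), continuous on [0,∞) and continuously differentiable on (0,∞), with 0<T_i(x)≤1, T_i'(x)<0, T_{i+1}(x)<T_i(x) for x>0, T_i(0)=1, which satisfy the first k−1 equations of the system (difeq) for x>0. Put Φ_k(t,x)=φ_k(T₁(x),…,T_{k−1}(x),t). Then for all x>0 the chain of inequalities holds: Φ_k(T_{k−1}(x),x) ≤ T_{k−1}'(x)/q(T_{k−1}(x)) < T_{k−1}'(x) < 0. -/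
open Set

/-- The standing hypotheses on `p, q` (with derivatives `p', q'`): `p, q` are
continuous on `[0,1]` and continuously differentiable on `(0,1]`, with
`p 0 = q 0 = 1`, `p 1 = q 1 = 0`, `p t > 0` for `t < 1`, `p' ≤ 0` and `q' < 0`
on `(0,1]`.  (In the duel `p = 1 - P₁`, `q = 1 - P₂`.) -/
def PQContext (p q p' q' : ℝ → ℝ) : Prop :=
  ContinuousOn p (Icc 0 1) ∧ ContinuousOn q (Icc 0 1) ∧
  (∀ t ∈ Ioc (0 : ℝ) 1, HasDerivWithinAt p (p' t) (Ioc 0 1) t) ∧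
  (∀ t ∈ Ioc (0 : ℝ) 1, HasDerivWithinAt q (q' t) (Ioc 0 1) t) ∧
  ContinuousOn p' (Ioc 0 1) ∧ ContinuousOn q' (Ioc 0 1) ∧
  p 0 = 1 ∧ q 0 = 1 ∧ p 1 = 0 ∧ q 1 = 0 ∧
  (∀ t ∈ Ico (0 : ℝ) 1, 0 < p t) ∧
  (∀ t ∈ Ioc (0 : ℝ) 1, p' t ≤ 0) ∧ (∀ t ∈ Ioc (0 : ℝ) 1, q' t < 0)

/-- `π_j(x) = ∏_{i=1}^{j} q (T_i x)`. -/
noncomputable def prodPi (q : ℝ → ℝ) (T : ℕ → ℝ → ℝ) (j : ℕ) (x : ℝ) : ℝ :=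
  ∏ i ∈ Finset.Icc 1 j, q (T i x)

/-- `Φ_k(t,x) = φ_k(T₁(x), …, T_{k-1}(x), t)`, the right-hand side of the `k`-th
equation of (difeq) with the last argument replaced by a free variable `t`. -/
noncomputable def Phik (p q q' : ℝ → ℝ) (T : ℕ → ℝ → ℝ) (k : ℕ) (t x : ℝ) : ℝ :=
  -(((1 - prodPi q T (k - 1) x * q t) * Real.log (p t)
      - (1 - prodPi q T (k - 1) x) * q t * Real.log (p (T (k - 1) x)))
    / (q' t * prodPi q T (k - 1) x))

lemma PQContext.strictAntiOn {p q p' q' : ℝ → ℝ} (h : PQContext p q p' q') :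
    StrictAntiOn q (Icc 0 1) := by
  obtain ⟨-, hqc, -, hqd, -, -, -, -, -, -, -, -, hq'⟩ := h
  refine strictAntiOn_of_deriv_neg (convex_Icc 0 1) hqc fun t ht ↦ ?_
  rw [interior_Icc] at ht
  rw [((hqd t (Ioo_subset_Ioc_self ht)).hasDerivAt (Ioc_mem_nhds ht.1 ht.2)).deriv]
  exact hq' t (Ioo_subset_Ioc_self ht)

lemma PQContext.antitoneOn {p q p' q' : ℝ → ℝ} (h : PQContext p q p' q') :
    AntitoneOn p (Icc 0 1) := by
  obtain ⟨hpc, -, hpd, -, -, -, -, -, -, -, -, hp', -⟩ := h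
  have hd : ∀ t ∈ interior (Icc (0 : ℝ) 1), HasDerivAt p (p' t) t := fun t ht ↦ by
    rw [interior_Icc] at ht
    exact (hpd t (Ioo_subset_Ioc_self ht)).hasDerivAt (Ioc_mem_nhds ht.1 ht.2)
  refine antitoneOn_of_deriv_nonpos (convex_Icc 0 1) hpc
    (fun t ht ↦ (hd t ht).differentiableAt.differentiableWithinAt) fun t ht ↦ ?_
  rw [(hd t ht).deriv]
  rw [interior_Icc] at ht
  exact hp' t (Ioo_subset_Ioc_self ht)

lemma PQContext.q_mem_Ioo {p q p' q' : ℝ → ℝ} (h : PQContext p q p' q') {t : ℝ}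
    (ht : t ∈ Ioo (0 : ℝ) 1) : q t ∈ Ioo (0 : ℝ) 1 := by
  have hanti := h.strictAntiOn
  obtain ⟨-, -, -, -, -, -, -, hq0, -, hq1, -⟩ := h
  have h0 := hanti (left_mem_Icc.2 zero_le_one) (Ioo_subset_Icc_self ht) ht.1
  have h1 := hanti (Ioo_subset_Icc_self ht) (right_mem_Icc.2 zero_le_one) ht.2
  exact ⟨hq1 ▸ h1, hq0 ▸ h0⟩

lemma lt_one_of_deriv_neg {f : ℝ → ℝ} (hc : ContinuousOn f (Ici 0))
    (hd : ∀ x, 0 < x → deriv f x < 0) (h0 : f 0 = 1) {x : ℝ} (hx : 0 < x) : f x < 1 := by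
  have hanti : StrictAntiOn f (Ici 0) :=
    strictAntiOn_of_deriv_neg (convex_Ici 0) hc fun t ht ↦ hd t (by simpa using ht)
  exact h0 ▸ hanti self_mem_Ici hx.le hx

/-- The algebraic core: `A` is the product of the earlier factors, `Q = q t`, `L = log (p t)`,
`M` the previous logarithm and `d = q' t`. -/
lemma fence_algebra {A Q L M d : ℝ} (hA : 0 < A) (hQ : 0 < Q) (hd : d < 0)
    (h : (1 - A) * M ≤ (1 - A) * L) :
    -(((1 - A * Q * Q) * L - (1 - A * Q) * Q * L) / (d * (A * Q))) ≤
      -(((1 - A * Q) * L - Q * (1 - A) * M) / (d * A)) / Q := by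
  have hrw : -(((1 - A * Q) * L - Q * (1 - A) * M) / (d * A)) / Q =
      -(((1 - A * Q) * L - Q * (1 - A) * M) / (d * (A * Q))) := by
    rw [neg_div, div_div, mul_assoc d A Q]
  rw [hrw, neg_le_neg_iff]
  refine div_le_div_of_nonpos_of_le (mul_neg_of_neg_of_pos hd (mul_pos hA hQ)).le ?_
  nlinarith [mul_le_mul_of_nonneg_left h hQ.le]

/-- Let `k ≥ 2` and let `T₁, …, T_{k-1}` satisfy the regularity,
monotonicity and initial conditions of the class `𝒯` together with the first `k-1`
equations of the system (difeq).  Then for all `x > 0` the chain of inequalities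
holds: `Φ_k (T_{k-1} x) x ≤ T_{k-1}' x / q (T_{k-1} x) < T_{k-1}' x < 0`. -/
theorem upper_fence_inequality
    (p q p' q' : ℝ → ℝ) (hpq : PQContext p q p' q')
    (k : ℕ) (hk : 2 ≤ k) (T : ℕ → ℝ → ℝ)
    (hTreg : ∀ i, 1 ≤ i → i ≤ k - 1 →
      ContinuousOn (T i) (Ici 0) ∧ ContDiffOn ℝ 1 (T i) (Ioi 0) ∧
      (∀ x, 0 ≤ x → 0 < T i x ∧ T i x ≤ 1) ∧
      (∀ x, 0 < x → deriv (T i) x < 0) ∧ T i 0 = 1)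
    (hTord : ∀ i, 1 ≤ i → i + 1 ≤ k - 1 → ∀ x, 0 < x → T (i + 1) x < T i x)
    (hTode : ∀ i, 1 ≤ i → i ≤ k - 1 → ∀ x, 0 < x →
      deriv (T i) x = difeqRHS p q q' T i x) :
    ∀ x, 0 < x →
      Phik p q q' T k (T (k - 1) x) x ≤ deriv (T (k - 1)) x / q (T (k - 1) x) ∧
      deriv (T (k - 1)) x / q (T (k - 1) x) < deriv (T (k - 1)) x ∧
      deriv (T (k - 1)) x < 0 := by
  intro x hx
  obtain ⟨n, rfl⟩ : ∃ n, k = n + 2 := ⟨k - 2, by omega⟩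
  rw [show n + 2 - 1 = n + 1 from rfl] at *
  have hT : ∀ i, 1 ≤ i → i ≤ n + 1 → T i x ∈ Ioo (0 : ℝ) 1 := fun i h1 h2 ↦ by
    obtain ⟨hc, -, hb, hd, h0⟩ := hTreg i h1 h2
    exact ⟨(hb x hx.le).1, lt_one_of_deriv_neg hc hd h0 hx⟩
  have hq : ∀ i, 1 ≤ i → i ≤ n + 1 → q (T i x) ∈ Ioo (0 : ℝ) 1 := fun i h1 h2 ↦
    hpq.q_mem_Ioo (hT i h1 h2)
  have hneg : deriv (T (n + 1)) x < 0 := (hTreg (n + 1) (by omega) le_rfl).2.2.2.1 x hx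
  have hQ := hq (n + 1) (by omega) le_rfl
  have ht := hT (n + 1) (by omega) le_rfl
  refine ⟨?_, ?_, hneg⟩
  · have hA : 0 < ∏ i ∈ Finset.Icc 1 n, q (T i x) := Finset.prod_pos fun i hi ↦ by
      rw [Finset.mem_Icc] at hi
      exact (hq i hi.1 (by omega)).1
    have hA1 : ∏ i ∈ Finset.Icc 1 n, q (T i x) ≤ 1 :=
      Finset.prod_le_one
        (fun i hi ↦ by
          rw [Finset.mem_Icc] at hi
          exact (hq i hi.1 (by omega)).1.le)
        (fun i hi ↦ by
          rw [Finset.mem_Icc] at hi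
          exact (hq i hi.1 (by omega)).2.le)
    have hanti := hpq.antitoneOn
    obtain ⟨-, -, -, -, -, -, -, -, -, -, hp, -, hq'⟩ := hpq
    rw [hTode (n + 1) (by omega) le_rfl x hx]
    simp only [Phik, prodPi, difeqRHS, Nat.add_sub_cancel,
      Finset.prod_Icc_succ_top (Nat.le_add_left 1 n), show n + 2 - 1 = n + 1 from rfl]
    refine fence_algebra hA hQ.1 (hq' _ (Ioo_subset_Ioc_self ht)) ?_
    rcases Nat.eq_zero_or_pos n with rfl | hn
    · simp
    · have hs := hT n hn (by omega)
      refine mul_le_mul_of_nonneg_left ?_ (sub_nonneg.2 hA1)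
      exact Real.log_le_log (hp _ (Ioo_subset_Ico_self hs))
        (hanti (Ioo_subset_Icc_self ht) (Ioo_subset_Icc_self hs) (hTord n hn le_rfl x hx).le)
  · rw [div_lt_iff₀ hQ.1]
    nlinarith [hQ.2]
end
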